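/- arXiv:1710.05079 — 4 statements merged into one kernel-verified Lean document; each statement's English description precedes it below -/
import Mathlib

section
/- Let H be the graph on ℕ^ℕ × [ℕ]^ℕ where (s,x) and (s',x') are adjacent iff s = s' and x, x' are adjacent in the shift graph G_S. There exists a Π⁰₂ set B ⊆ ℕ^ℕ × (ℕ^ℕ × [ℕ]^ℕ) such that the set {s ∈ ℕ^ℕ : χ_B(H|_{B_s}) < ∞} is Σ¹₂-hard. -/
open MeasureTheory Set

/-- The Baire space `ℕ^ℕ`. -/
abbrev NN : Type := ℕ → ℕ

/-- The space `[ℕ]^ℕ` of infinite subsets of `ℕ`, identified with their increasing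
enumerations, with the topology inherited from `ℕ^ℕ`. -/
abbrev IncSeq : Type := {x : NN // StrictMono x}

/-- The shift map `S(x) = x \ {min x}`. -/
def shift (x : IncSeq) : IncSeq :=
  ⟨fun n => x.1 (n + 1), fun _ _ h => x.2 (Nat.add_lt_add_right h 1)⟩

/-- The edge relation of the shift graph `G_S` on `[ℕ]^ℕ`. -/
def shiftEdge (x y : IncSeq) : Prop := x ≠ y ∧ (shift x = y ∨ shift y = x)

/-- `G_S|_B` admits a Borel coloring with `n` colors. -/
def BorelColoringLE (B : Set IncSeq) (n : ℕ) : Prop :=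
  ∃ c : B → Fin n, Measurable c ∧ ∀ x y : B, shiftEdge x.1 y.1 → c x ≠ c y

/-- Coanalytic (`Π¹₁`) subsets of a topological space. -/
def IsCoanalytic {X : Type} [TopologicalSpace X] (S : Set X) : Prop := AnalyticSet Sᶜ

/-- `Σ¹₂` subsets of a topological space: projections of coanalytic subsets of `X × ℕ^ℕ`. -/
def IsSigma12 {X : Type} [TopologicalSpace X] (A : Set X) : Prop :=
  ∃ C : Set (X × NN), IsCoanalytic C ∧ A = Prod.fst '' C

/-- `A` is `Σ¹₂`-hard: every `Σ¹₂` subset of a Polish space Borel-reduces to `A`. -/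
def Sigma12Hard {X : Type} [MeasurableSpace X] (A : Set X) : Prop :=
  ∀ (Z : Type) [TopologicalSpace Z] [PolishSpace Z] [MeasurableSpace Z] [BorelSpace Z],
    ∀ A' : Set Z, IsSigma12 A' → ∃ f : Z → X, Measurable f ∧ ∀ z, z ∈ A' ↔ f z ∈ A

/-- The edge relation of the graph `ℋ` on `ℕ^ℕ × [ℕ]^ℕ`: `(s,x)` and `(s',x')` are
adjacent iff `s = s'` and `x, x'` are adjacent in the shift graph. -/
def HEdge (p q : NN × IncSeq) : Prop := p.1 = q.1 ∧ shiftEdge p.2 q.2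

/-- `ℋ|_D` admits a Borel coloring with `n` colors. -/
def HColoringLE (D : Set (NN × IncSeq)) (n : ℕ) : Prop :=
  ∃ c : D → Fin n, Measurable c ∧ ∀ p q : D, HEdge p.1 q.1 → c p ≠ c q

/-- `Π⁰₂` subsets of a topological space: countable intersections of open sets. -/
def IsPi02 {X : Type} [TopologicalSpace X] (S : Set X) : Prop :=
  ∃ U : ℕ → Set X, (∀ n, IsOpen (U n)) ∧ S = ⋂ n, U n


open PiNat Filter Topology

/-! ### Ultrafilter trees -/

/-- Branches through `σ` (a reversed finite sequence) all of whose later values lie in the sets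
prescribed by `F`. -/
def ultraBox (F : List ℕ → Set ℕ) (σ : List ℕ) : Set NN :=
  {x | res x σ.length = σ ∧ ∀ n, σ.length ≤ n → x n ∈ F (res x n)}

/-- `F` prescribes a set of the ultrafilter at every node. -/
def IsLarge (F : List ℕ → Set ℕ) : Prop := ∀ τ, F τ ∈ (hyperfilter ℕ : Filter ℕ)

/-- Every node is the stem of an ultrafilter tree contained in `A` or disjoint from it. -/
def Decided (A : Set NN) : Prop :=
  ∀ σ, ∃ F, IsLarge F ∧ (ultraBox F σ ⊆ A ∨ ultraBox F σ ⊆ Aᶜ)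

theorem Decided.compl {A : Set NN} (h : Decided A) : Decided Aᶜ := by
  intro σ
  obtain ⟨F, hF, h1 | h1⟩ := h σ
  · exact ⟨F, hF, Or.inr (by rwa [compl_compl])⟩
  · exact ⟨F, hF, Or.inl h1⟩

theorem decided_coord (i a : ℕ) : Decided {x : NN | x i = a} := by
  intro σ
  rcases Nat.lt_or_ge i σ.length with hi | hi
  · refine ⟨fun _ => univ, fun _ => univ_mem, ?_⟩
    by_cases h : ∃ x : NN, res x σ.length = σ ∧ x i = a
    · obtain ⟨x, hx, hxa⟩ := h
      refine Or.inl fun y hy => ?_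
      have := res_eq_res.1 (hx.trans hy.1.symm) hi
      exact this.symm.trans hxa
    · exact Or.inr fun y hy hya => h ⟨y, hy.1, hya⟩
  · refine ⟨fun _ => {a}ᶜ, fun _ => ?_, Or.inr fun x hx => hx.2 i hi⟩
    exact mem_hyperfilter_of_finite_compl (by simp)

theorem res_suffix_res (x : NN) {m n : ℕ} (h : m ≤ n) : res x m <:+ res x n := by
  induction n, h using Nat.le_induction with
  | base => exact List.suffix_rfl
  | succ n _ ih => exact ih.trans (List.suffix_cons _ _)

theorem Decided.iUnion {A : ℕ → Set NN} (h : ∀ n, Decided (A n)) : Decided (⋃ n, A n) := by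
  classical
  let good : List ℕ → Prop := fun σ => ∃ F, IsLarge F ∧ ultraBox F σ ⊆ ⋃ n, A n
  have bad_succ : ∀ σ, ¬ good σ → {m | ¬ good (m :: σ)} ∈ (hyperfilter ℕ : Filter ℕ) := by
    intro σ hσ
    by_contra hcon
    have hg : {m | good (m :: σ)} ∈ (hyperfilter ℕ : Filter ℕ) :=
      mem_of_superset (Ultrafilter.compl_mem_iff_notMem.2 hcon) fun m hm => not_not.1 hm
    have hch : ∀ m, ∃ F, IsLarge F ∧ (good (m :: σ) → ultraBox F (m :: σ) ⊆ ⋃ n, A n) := by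
      intro m
      by_cases hm : good (m :: σ)
      · obtain ⟨F, hF, hF'⟩ := hm
        exact ⟨F, hF, fun _ => hF'⟩
      · exact ⟨fun _ => univ, fun _ => univ_mem, fun h => absurd h hm⟩
    choose F hF hFA using hch
    apply hσ
    refine ⟨fun τ => {k | (τ = σ → good (k :: σ)) ∧ ∀ m, (m :: σ) <:+ τ → k ∈ F m τ}, ?_, ?_⟩
    · intro τ
      have h1 : {k | τ = σ → good (k :: σ)} ∈ (hyperfilter ℕ : Filter ℕ) := by
        by_cases hτ : τ = σ
        · exact mem_of_superset hg fun k hk _ => hk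
        · exact mem_of_superset univ_mem fun k _ h => absurd h hτ
      have h2 : {k | ∀ m, (m :: σ) <:+ τ → k ∈ F m τ} ∈ (hyperfilter ℕ : Filter ℕ) := by
        by_cases hm : ∃ m, (m :: σ) <:+ τ
        · obtain ⟨m, hm⟩ := hm
          refine mem_of_superset (hF m τ) fun k hk m' hm' => ?_
          have : m' :: σ = m :: σ :=
            (List.suffix_of_suffix_length_le hm' hm (by simp)).eq_of_length (by simp)
          rw [(List.cons.inj this).1]
          exact hk
        · push Not at hm
          exact mem_of_superset univ_mem fun k _ m hm' => absurd hm' (hm m)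
      exact inter_mem h1 h2
    · intro x hx
      have h0 := hx.2 σ.length le_rfl
      have hgood := h0.1 hx.1
      have hres : res x (x σ.length :: σ).length = x σ.length :: σ := by
        rw [List.length_cons, res_succ, hx.1]
      refine hFA _ hgood ⟨hres, fun n hn => ?_⟩
      have hn' : σ.length + 1 ≤ n := by simpa using hn
      refine (hx.2 n (by omega)).2 _ ?_
      rw [← hres]
      exact res_suffix_res x hn
  intro σ
  by_cases hσ : good σ
  · obtain ⟨F, hF, hFA⟩ := hσ
    exact ⟨F, hF, Or.inl hFA⟩
  have hch : ∀ τ n, ∃ F, IsLarge F ∧ (¬ good τ → ultraBox F τ ⊆ (A n)ᶜ) := by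
    intro τ n
    obtain ⟨F, hF, h1 | h1⟩ := h n τ
    · exact ⟨F, hF, fun hb => absurd ⟨F, hF, h1.trans (subset_iUnion A n)⟩ hb⟩
    · exact ⟨F, hF, fun _ => h1⟩
  choose F hF hFA using hch
  refine ⟨fun τ => {m | (¬ good τ → ¬ good (m :: τ)) ∧
    ∀ ρ ∈ {ρ | ρ <:+ τ}, ∀ n ∈ Set.Iic ρ.length, m ∈ F ρ n τ}, ?_, Or.inr ?_⟩
  · intro τ
    refine inter_mem ?_ ?_
    · by_cases hτ : good τ
      · exact mem_of_superset univ_mem fun m _ h => absurd hτ h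
      · exact mem_of_superset (bad_succ τ hτ) fun m hm _ => hm
    · have hfin : {ρ | ρ <:+ τ}.Finite :=
        (List.finite_toSet τ.tails).subset fun ρ hρ => (List.mem_tails _ _).2 hρ
      have : (⋂ ρ ∈ {ρ | ρ <:+ τ}, ⋂ n ∈ Set.Iic ρ.length, F ρ n τ) ∈
          (hyperfilter ℕ : Filter ℕ) :=
        (biInter_mem hfin).2 fun ρ _ => (biInter_mem (Set.finite_Iic _)).2 fun n _ => hF ρ n τ
      refine mem_of_superset this fun m hm => ?_
      simp only [mem_iInter] at hm
      exact hm
  · intro x hx hxA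
    obtain ⟨N, hN⟩ := mem_iUnion.1 hxA
    have hbad : ∀ n, σ.length ≤ n → ¬ good (res x n) := by
      intro n hn
      induction n, hn using Nat.le_induction with
      | base => rwa [hx.1]
      | succ n hn ih => exact (hx.2 n hn).1 ih
    let n := max N σ.length
    refine hFA (res x n) N (hbad n (le_max_right _ _)) ⟨by rw [res_length], fun k hk => ?_⟩ hN
    rw [res_length] at hk
    exact (hx.2 k ((le_max_right _ _).trans hk)).2 _ (res_suffix_res x hk) _
      (by simp [n, res_length])

/-- The σ-algebra of decided sets. -/
abbrev decidedSpace : MeasurableSpace NN where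
  MeasurableSet' := Decided
  measurableSet_empty := fun σ => ⟨fun _ => univ, fun _ => univ_mem, Or.inr (by simp)⟩
  measurableSet_compl := fun _ h => h.compl
  measurableSet_iUnion := fun _ h => Decided.iUnion h

theorem MeasurableSet.decided {A : Set NN} (hA : MeasurableSet A) : Decided A := by
  have h : @Measurable NN NN decidedSpace MeasurableSpace.pi id :=
    (@measurable_pi_iff NN ℕ (fun _ => ℕ) decidedSpace _ id).2 fun i =>
      @measurable_to_countable' ℕ NN _ _ decidedSpace _ fun a => decided_coord i a
  exact h hA

theorem exists_forall_mem_res {F : List ℕ → Set ℕ} (hF : IsLarge F) :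
    ∃ y : NN, ∀ k, y k ∈ F (res y k) := by
  have hne : ∀ τ, ∃ m, m ∈ F τ := fun τ => Ultrafilter.nonempty_of_mem (hF τ)
  choose g hg using hne
  let l : ℕ → List ℕ := fun k => Nat.rec [] (fun _ t => g t :: t) k
  have hl : ∀ k, res (fun k => g (l k)) k = l k := by
    intro k
    induction k with
    | zero => rfl
    | succ k ih => rw [res_succ, ih]
  exact ⟨fun k => g (l k), fun k => by rw [hl]; exact hg _⟩

/-- A finite Borel partition of Baire space has a cell containing a strictly increasing sequence
together with its shift. -/
theorem exists_strictMono_eq_shift {ι : Type*} [Finite ι] (c : NN → ι)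
    (hc : ∀ i, MeasurableSet {x | c x = i}) :
    ∃ x : NN, StrictMono x ∧ c x = c fun n => x (n + 1) := by
  have hdec := fun i => (hc i).decided []
  choose F hF hdec using hdec
  obtain ⟨i, hi⟩ : ∃ i, ultraBox (F i) [] ⊆ {x | c x = i} := by
    by_contra! hcon
    obtain ⟨y, hy⟩ := exists_forall_mem_res (F := fun τ => ⋂ i, F i τ)
      fun τ => iInter_mem.2 fun i => hF i τ
    refine (hdec (c y)).resolve_left (hcon (c y)) ⟨rfl, fun n _ => ?_⟩ rfl
    exact mem_iInter.1 (hy n) (c y)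
  obtain ⟨n, hn⟩ := Ultrafilter.nonempty_of_mem (hF i [])
  obtain ⟨y, hy⟩ := exists_forall_mem_res
    (F := fun τ => F i τ ∩ (F i (τ ++ [n]) ∩ {m | ∀ j ∈ n :: τ, j < m})) fun τ => by
      refine inter_mem (hF i _) (inter_mem (hF i _) ?_)
      have := (biInter_mem (List.finite_toSet (n :: τ)) (f := (hyperfilter ℕ : Filter ℕ))
        (s := fun j => {m | j < m})).2
        fun j _ => mem_hyperfilter_of_finite_compl ((Set.finite_Iic j).subset fun m hm => by
          simpa using hm)
      refine mem_of_superset this fun m hm j hj => ?_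
      exact mem_iInter₂.1 hm j hj
  let x : NN := fun k => Nat.casesOn k n y
  have hres : ∀ k, res x (k + 1) = res y k ++ [n] := by
    intro k
    induction k with
    | zero => rfl
    | succ k ih => rw [res_succ, ih]; rfl
  refine ⟨x, strictMono_nat_of_lt_succ fun k => ?_, ?_⟩
  · cases k with
    | zero => exact (hy 0).2.2 n (by simp)
    | succ k => exact (hy (k + 1)).2.2 (y k) (by simp [res_succ])
  · have h1 : c x = i := hi ⟨rfl, fun k _ => by
      cases k with
      | zero => exact hn
      | succ k => rw [hres]; exact (hy k).2.1⟩
    have h2 : c y = i := hi ⟨rfl, fun k _ => (hy k).1⟩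
    exact h1.trans h2.symm

/-! ### Codes for Borel sets -/

/-- Well-founded terms describing Borel subsets of Baire space. -/
inductive BorelTerm : Type
  | basic (t : ℕ) : BorelTerm
  | nor (f : ℕ → BorelTerm) : BorelTerm

/-- Interleaving of two sequences. -/
def interleave (s x : NN) : NN := fun i => if i % 2 = 0 then s (i / 2) else x (i / 2)

theorem continuous_interleave : Continuous fun p : NN × NN => interleave p.1 p.2 := by
  refine continuous_pi fun i => ?_
  unfold interleave
  split_ifs <;> fun_prop

namespace BorelTerm

/-- Membership in the set described by a term. -/
def Holds : BorelTerm → NN → Prop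
  | basic t, r => r (Nat.unpair t).1 = (Nat.unpair t).2
  | nor f, r => ∀ m, ¬ (f m).Holds r

/-- Sets of the form `{p | b.Holds (interleave p.1 p.2)}`. -/
def Represents (b : BorelTerm) (A : Set (NN × IncSeq)) : Prop :=
  ∀ p, p ∈ A ↔ b.Holds (interleave p.1 p.2.1)

theorem Represents.compl {b : BorelTerm} {A : Set (NN × IncSeq)} (h : b.Represents A) :
    (nor fun _ => b).Represents Aᶜ := fun p => by
  simp [Holds, h p]

theorem Represents.iUnion {b : ℕ → BorelTerm} {A : ℕ → Set (NN × IncSeq)}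
    (h : ∀ n, (b n).Represents (A n)) : (nor fun _ => nor b).Represents (⋃ n, A n) := fun p => by
  simp [Holds, (h _ p)]

theorem exists_represents_empty : ∃ b : BorelTerm, b.Represents ∅ := by
  refine ⟨nor fun k => if k = 0 then basic 0 else nor fun _ => basic 0, fun p => ?_⟩
  refine iff_of_false (fun h => h) fun h => ?_
  have h1 := h 1
  simp only [one_ne_zero, if_false] at h1
  exact h1 fun _ => h 0

/-- The σ-algebra of sets described by terms. -/
abbrev representedSpace : MeasurableSpace (NN × IncSeq) where
  MeasurableSet' A := ∃ b : BorelTerm, b.Represents A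
  measurableSet_empty := exists_represents_empty
  measurableSet_compl := fun _ ⟨_, h⟩ => ⟨_, h.compl⟩
  measurableSet_iUnion := fun _ h => by
    choose b hb using h
    exact ⟨_, Represents.iUnion hb⟩

theorem exists_represents {A : Set (NN × IncSeq)} (hA : MeasurableSet A) :
    ∃ b : BorelTerm, b.Represents A := by
  have h1 : @Measurable _ NN representedSpace MeasurableSpace.pi
      (fun p : NN × IncSeq => p.1) :=
    (@measurable_pi_iff _ ℕ (fun _ => ℕ) representedSpace _ _).2 fun i =>
      @measurable_to_countable' ℕ _ _ _ representedSpace _ fun a =>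
        ⟨basic (Nat.pair (2 * i) a), fun p => by simp [Holds, interleave]⟩
  have h2 : @Measurable _ NN representedSpace MeasurableSpace.pi
      (fun p : NN × IncSeq => p.2.1) :=
    (@measurable_pi_iff _ ℕ (fun _ => ℕ) representedSpace _ _).2 fun i =>
      @measurable_to_countable' ℕ _ _ _ representedSpace _ fun a =>
        ⟨basic (Nat.pair (2 * i + 1) a), fun p => by
          have : (2 * i + 1) / 2 = i := by omega
          simp [Holds, interleave, this]⟩
  have h3 : @Measurable _ IncSeq representedSpace _ (fun p : NN × IncSeq => p.2) :=
    @Measurable.subtype_mk _ _ representedSpace _ _ _ h2 (fun p => p.2.2)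
  have h4 : @Measurable _ _ representedSpace Prod.instMeasurableSpace
      (fun p : NN × IncSeq => (p.1, p.2)) :=
    @Measurable.prodMk _ representedSpace _ _ _ _ _ _ h1 h3
  exact h4 hA

/-- Immediate subterms. -/
def child : BorelTerm → ℕ → BorelTerm
  | basic t, _ => basic t
  | nor f, m => f m

/-- Subterm at a position, positions being read from right to left. -/
def sub (b : BorelTerm) : List ℕ → BorelTerm
  | [] => b
  | m :: τ => (b.sub τ).child m

/-- The label of the root of a term. -/
def kind : BorelTerm → ℕ
  | basic t => t + 1
  | nor _ => 0

/-- A real coding a number together with a term. -/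
def code (n : ℕ) (b : BorelTerm) : NN
  | 0 => n
  | k + 1 => (b.sub (Denumerable.ofNat (List ℕ) k)).kind

end BorelTerm

/-- The label at position `τ` of the coded term. -/
def label (s : NN) (τ : List ℕ) : ℕ := s (Encodable.encode τ + 1)

theorem BorelTerm.label_code (n : ℕ) (b : BorelTerm) (τ : List ℕ) :
    label (b.code n) τ = (b.sub τ).kind := by
  simp [label, BorelTerm.code]

/-- The child relation of the coded tree of positions. -/
def ChildRel (s : NN) (τ' τ : List ℕ) : Prop := label s τ = 0 ∧ ∃ a, τ' = a :: τ

/-- `e` is a Skolemized evaluation along `r` of the term coded by `s`. -/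
def IsEval (s r : NN) (e : List ℕ → ℕ) : Prop :=
  ∀ τ, (label s τ = 0 → e τ = 0 → ∀ m, e (m :: τ) ≠ 0) ∧
    (label s τ = 0 → ∀ m, e τ = m + 1 → e (m :: τ) = 0) ∧
    ∀ t, label s τ = t + 1 → (e τ = 0 ↔ r (Nat.unpair t).1 = (Nat.unpair t).2)

theorem BorelTerm.wellFounded_code (n : ℕ) (c : BorelTerm) : WellFounded (ChildRel (c.code n)) := by
  have key : ∀ b τ, c.sub τ = b → Acc (ChildRel (c.code n)) τ := by
    intro b
    induction b with
    | basic t =>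
      intro τ hτ
      refine ⟨_, fun τ' h => ?_⟩
      have := h.1
      rw [label_code, hτ] at this
      exact absurd this (Nat.succ_ne_zero t)
    | nor f ih =>
      intro τ hτ
      refine ⟨_, fun τ' ⟨_, a, ha⟩ => ih a _ ?_⟩
      rw [ha, sub, hτ, child]
  exact ⟨fun τ => key _ τ rfl⟩

theorem IsEval.eq_zero_iff {n : ℕ} {c : BorelTerm} {r : NN} {e : List ℕ → ℕ}
    (h : IsEval (c.code n) r e) (τ : List ℕ) : e τ = 0 ↔ (c.sub τ).Holds r := by
  have key : ∀ b τ, c.sub τ = b → (e τ = 0 ↔ b.Holds r) := by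
    intro b
    induction b with
    | basic t =>
      intro τ hτ
      refine (h τ).2.2 t ?_
      rw [BorelTerm.label_code, hτ, BorelTerm.kind]
    | nor f ih =>
      intro τ hτ
      have hl : label (c.code n) τ = 0 := by rw [BorelTerm.label_code, hτ, BorelTerm.kind]
      have hc : ∀ m, e (m :: τ) = 0 ↔ (f m).Holds r := fun m =>
        ih m _ (by rw [BorelTerm.sub, hτ, BorelTerm.child])
      refine ⟨fun he m hm => (h τ).1 hl he m ((hc m).2 hm), fun hf => ?_⟩
      by_contra he
      obtain ⟨m, hm⟩ := Nat.exists_eq_succ_of_ne_zero he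
      exact hf m ((hc m).1 ((h τ).2.1 hl m hm))
  exact key _ τ rfl

theorem exists_isEval {s : NN} (hs : WellFounded (ChildRel s)) :
    ∃ (S : List ℕ → Set NN) (e : NN → List ℕ → ℕ), (∀ τ, MeasurableSet (S τ)) ∧
      ∀ r, IsEval s r (e r) ∧ ∀ τ, e r τ = 0 ↔ r ∈ S τ := by
  classical
  let step : ∀ τ, (∀ τ', ChildRel s τ' τ → {A : Set NN // MeasurableSet A}) →
      {A : Set NN // MeasurableSet A} := fun τ ih =>
    if h : label s τ = 0 then ⟨⋂ m, ((ih (m :: τ) ⟨h, m, rfl⟩).1)ᶜ,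
      MeasurableSet.iInter fun m => (ih (m :: τ) ⟨h, m, rfl⟩).2.compl⟩
    else ⟨{r | r (Nat.unpair (label s τ - 1)).1 = (Nat.unpair (label s τ - 1)).2},
      measurableSet_eq_fun (measurable_pi_apply _) measurable_const⟩
  let S : List ℕ → {A : Set NN // MeasurableSet A} := hs.fix step
  have hS : ∀ τ, S τ = step τ fun τ' _ => S τ' := fun τ => hs.fix_eq step τ
  have h0 : ∀ τ, label s τ = 0 → ∀ r, r ∈ (S τ).1 ↔ ∀ m, r ∉ (S (m :: τ)).1 := by
    intro τ hτ r
    rw [hS]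
    simp [step, hτ]
  have h1 : ∀ τ t, label s τ = t + 1 →
      ∀ r, r ∈ (S τ).1 ↔ r (Nat.unpair t).1 = (Nat.unpair t).2 := by
    intro τ t hτ r
    rw [hS]
    simp [step, hτ]
  refine ⟨fun τ => (S τ).1,
    fun r τ => if r ∈ (S τ).1 then 0 else sInf {m | r ∈ (S (m :: τ)).1} + 1,
    fun τ => (S τ).2, fun r => ⟨fun τ => ⟨fun hτ he m => ?_, fun hτ m he => ?_, fun t ht => ?_⟩,
      fun τ => ?_⟩⟩
  · have : r ∈ (S τ).1 := by
      by_contra hcon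
      simp [hcon] at he
    simp [(h0 τ hτ r).1 this m]
  · have hr : r ∉ (S τ).1 := by
      intro hcon
      simp [hcon] at he
    simp only [hr, if_false, Nat.add_right_cancel_iff] at he
    have hne : {m | r ∈ (S (m :: τ)).1}.Nonempty := by
      by_contra hcon
      exact hr ((h0 τ hτ r).2 fun m hm => hcon ⟨m, hm⟩)
    have := Nat.sInf_mem hne
    rw [he] at this
    exact if_pos this
  · rw [← h1 τ t ht r]
    simp
  · simp

/-! ### Monochromatic edges as branches of a tree -/

section closed

variable {X : Type*} [TopologicalSpace X]

theorem isClosed_forall {ι : Sort*} {P : ι → X → Prop} (h : ∀ i, IsClosed {x | P i x}) :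
    IsClosed {x | ∀ i, P i x} := by
  have : {x | ∀ i, P i x} = ⋂ i, {x | P i x} := by
    ext
    simp
  rw [this]
  exact isClosed_iInter h

theorem isClosed_and {P Q : X → Prop} (hP : IsClosed {x | P x}) (hQ : IsClosed {x | Q x}) :
    IsClosed {x | P x ∧ Q x} :=
  hP.inter hQ

theorem isClosed_of_discrete {D : Type*} [TopologicalSpace D] [DiscreteTopology D] {f : X → D}
    (hf : Continuous f) (P : D → Prop) : IsClosed {x | P (f x)} :=
  (isClosed_discrete {d | P d}).preimage hf

theorem isClosed_isEval {s r : X → NN} {e : X → List ℕ → ℕ} (hs : Continuous s)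
    (hr : Continuous r) (he : ∀ τ, Continuous fun x => e x τ) :
    IsClosed {x | IsEval (s x) (r x) (e x)} := by
  have hl : ∀ τ, Continuous fun x => label (s x) τ := fun τ => (continuous_apply _).comp hs
  refine isClosed_forall fun τ => isClosed_and ?_ (isClosed_and ?_ (isClosed_forall fun t => ?_))
  · have : IsClosed {x | ∀ m, label (s x) τ = 0 → e x τ = 0 → e x (m :: τ) ≠ 0} :=
      isClosed_forall fun m => isClosed_of_discrete
        ((hl τ).prodMk ((he τ).prodMk (he (m :: τ)))) fun d => d.1 = 0 → d.2.1 = 0 → d.2.2 ≠ 0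
    convert this using 2
    exact funext fun x => propext ⟨fun h m a b => h a b m, fun h a b m => h m a b⟩
  · have : IsClosed {x | ∀ m, label (s x) τ = 0 → e x τ = m + 1 → e x (m :: τ) = 0} :=
      isClosed_forall fun m => isClosed_of_discrete
        ((hl τ).prodMk ((he τ).prodMk (he (m :: τ)))) fun d => d.1 = 0 → d.2.1 = m + 1 → d.2.2 = 0
    convert this using 2
    exact funext fun x => propext ⟨fun h m a => h a m, fun h a m => h m a⟩
  · exact isClosed_of_discrete
      ((hl τ).prodMk ((he τ).prodMk ((continuous_apply (Nat.unpair t).1).comp hr)))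
      fun d => d.1 = t + 1 → (d.2.1 = 0 ↔ d.2.2 = (Nat.unpair t).2)

end closed

/-- Removing the first entry. -/
def dropFirst (x : NN) : NN := fun n => x (n + 1)

/-- The sequence coded by `v`. -/
def seqPart (v : NN) : NN := fun j => v (3 * j + 1)

/-- The first evaluation coded by `v`. -/
def evalPart (v : NN) : List ℕ → ℕ := fun τ => v (3 * Encodable.encode τ + 2)

/-- The second evaluation coded by `v`. -/
def evalPart' (v : NN) : List ℕ → ℕ := fun τ => v (3 * Encodable.encode τ + 3)

/-- `v` codes an edge of the shift graph which is not properly colored by the coloring coded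
by `s`; the entry `v 0` is the second element of the starting point of that edge. -/
def MonoEdge (s v : NN) : Prop :=
  v 0 = v 4 ∧ (∀ j, seqPart v j < seqPart v (j + 1)) ∧
    IsEval s (interleave s (seqPart v)) (evalPart v) ∧
    IsEval s (interleave s (dropFirst (seqPart v))) (evalPart' v) ∧
    ∀ i < s 0, (evalPart v [i] = 0 ↔ evalPart' v [i] = 0)

/-- `v` witnesses that `s` does not code a well-founded term. -/
def Fault (s v : NN) : Prop :=
  ∀ i, ChildRel s (Denumerable.ofNat (List ℕ) (v (i + 1))) (Denumerable.ofNat (List ℕ) (v i))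

/-- `v` witnesses that `s` does not code a coloring of the shift graph. -/
def Witness (s v : NN) : Prop := MonoEdge s v ∨ Fault s v

theorem continuous_dropFirst : Continuous dropFirst := by
  unfold dropFirst
  fun_prop

theorem continuous_seqPart : Continuous seqPart := by
  unfold seqPart
  fun_prop

theorem isClosed_witness : IsClosed {p : NN × NN | Witness p.1 p.2} := by
  refine IsClosed.union (isClosed_and ?_ (isClosed_and (isClosed_forall fun j => ?_)
    (isClosed_and (isClosed_isEval ?_ ?_ fun τ => ?_)
    (isClosed_and (isClosed_isEval ?_ ?_ fun τ => ?_)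
    (isClosed_forall fun i => ?_))))) (isClosed_forall fun i => ?_)
  · exact isClosed_eq (by fun_prop) (by fun_prop)
  · exact isClosed_of_discrete (f := fun p : NN × NN => (seqPart p.2 j, seqPart p.2 (j + 1)))
      (by unfold seqPart; fun_prop) fun d => d.1 < d.2
  · exact continuous_fst
  · exact continuous_interleave.comp
      (continuous_fst.prodMk (continuous_seqPart.comp continuous_snd))
  · unfold evalPart
    fun_prop
  · exact continuous_fst
  · exact continuous_interleave.comp
      (continuous_fst.prodMk (continuous_dropFirst.comp (continuous_seqPart.comp continuous_snd)))
  · unfold evalPart'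
    fun_prop
  · exact isClosed_of_discrete
      (f := fun p : NN × NN => (p.1 0, evalPart p.2 [i], evalPart' p.2 [i]))
      (by unfold evalPart evalPart'; fun_prop) fun d => i < d.1 → (d.2.1 = 0 ↔ d.2.2 = 0)
  · have : {p : NN × NN | ChildRel p.1 (Denumerable.ofNat (List ℕ) (p.2 (i + 1)))
        (Denumerable.ofNat (List ℕ) (p.2 i))} =
        {p : NN × NN | ∀ k l, p.2 i = k → p.2 (i + 1) = l →
          ChildRel p.1 (Denumerable.ofNat (List ℕ) l) (Denumerable.ofNat (List ℕ) k)} := by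
      ext p
      simp
    rw [this]
    refine isClosed_forall fun k => isClosed_forall fun l => ?_
    exact isClosed_of_discrete (f := fun p : NN × NN =>
      (p.2 i, p.2 (i + 1), label p.1 (Denumerable.ofNat (List ℕ) k)))
      (by unfold label; fun_prop) fun d => d.1 = k → d.2.1 = l → (d.2.2 = 0 ∧
        ∃ a, Denumerable.ofNat (List ℕ) l = a :: Denumerable.ofNat (List ℕ) k)

theorem exists_witness (s : NN) : ∃ v, Witness s v := by
  classical
  by_cases hs : WellFounded (ChildRel s)
  · obtain ⟨S, e, hS, he⟩ := exists_isEval hs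
    have hmeas : ∀ i, MeasurableSet {x : NN | interleave s x ∈ S [i]} := fun i =>
      (continuous_interleave.comp (continuous_const.prodMk continuous_id)).measurable (hS [i])
    obtain ⟨x, hx, hcx⟩ := exists_strictMono_eq_shift
      (fun x => fun i : Fin (s 0) => (interleave s x ∈ S [i.1] : Prop)) fun p => by
        have : {x : NN | (fun i : Fin (s 0) => (interleave s x ∈ S [i.1] : Prop)) = p} =
            ⋂ i, {x : NN | interleave s x ∈ S [i.1] ↔ p i} := by
          ext x
          simp [funext_iff]
        rw [this]
        refine MeasurableSet.iInter fun i => ?_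
        by_cases hp : p i
        · simpa [hp] using hmeas i
        · simp only [hp, iff_false]
          exact (hmeas i).compl
    let v : NN := fun k => if k = 0 then x 1 else if k % 3 = 1 then x (k / 3) else
      if k % 3 = 2 then e (interleave s x) (Denumerable.ofNat (List ℕ) (k / 3))
      else e (interleave s (dropFirst x)) (Denumerable.ofNat (List ℕ) (k / 3 - 1))
    have h1 : seqPart v = x := by
      funext j
      have a : (3 * j + 1) % 3 = 1 := by omega
      have b : (3 * j + 1) / 3 = j := by omega
      simp [seqPart, v, a, b]
    have h2 : evalPart v = e (interleave s x) := by
      funext τ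
      have a : (3 * Encodable.encode τ + 2) % 3 = 2 := by omega
      have b : (3 * Encodable.encode τ + 2) / 3 = Encodable.encode τ := by omega
      simp [evalPart, v, a, b]
    have h3 : evalPart' v = e (interleave s (dropFirst x)) := by
      funext τ
      have a : (3 * Encodable.encode τ + 3) % 3 = 0 := by omega
      simp [evalPart', v, a]
    refine ⟨v, Or.inl ⟨rfl, ?_, ?_, ?_, fun i hi => ?_⟩⟩
    · rw [h1]
      exact fun j => hx j.lt_succ_self
    · rw [h1, h2]
      exact (he _).1
    · rw [h1, h3]
      exact (he _).1
    · rw [h2, h3, (he _).2, (he _).2]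
      exact iff_of_eq (congrFun hcx ⟨i, hi⟩)
  · rw [wellFounded_iff_isEmpty_descending_chain, not_isEmpty_iff] at hs
    obtain ⟨⟨f, hf⟩⟩ := hs
    exact ⟨fun i => Encodable.encode (f i), Or.inr fun i => by simpa using hf i⟩

theorem BorelTerm.monoEdge_of_witness {n : ℕ} {b : BorelTerm} {v : NN}
    (h : Witness (b.code n) v) : MonoEdge (b.code n) v := by
  refine h.resolve_right fun hf => ?_
  exact (wellFounded_iff_isEmpty_descending_chain.1 (b.wellFounded_code n)).false ⟨_, hf⟩

/-! ### Strategies for staying inside the tree of witnesses -/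

section locallyConstant

variable {X : Type*} [TopologicalSpace X]

theorem IsLocallyConstant.eventually {D : Type*} {f : X → D} (hf : IsLocallyConstant f) (x : X) :
    ∀ᶠ x' in 𝓝 x, f x' = f x :=
  (IsLocallyConstant.iff_eventually_eq f).1 hf x

theorem isLocallyConstant_of_eventually {D : Type*} {f : X → D}
    (hf : ∀ x, ∀ᶠ x' in 𝓝 x, f x' = f x) : IsLocallyConstant f :=
  (IsLocallyConstant.iff_eventually_eq f).2 hf

theorem IsLocallyConstant.isClosed_setOf {P : X → Prop} (hP : IsLocallyConstant P) :
    IsClosed {x | P x} :=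
  isOpen_compl_iff.1 (hP {p | ¬ p})

theorem Continuous.isLocallyConstant_apply {y : X → NN} (hy : Continuous y) (i : ℕ) :
    IsLocallyConstant fun x => y x i :=
  (IsLocallyConstant.iff_continuous _).2 ((continuous_apply i).comp hy)

theorem Continuous.isLocallyConstant_res {y : X → NN} (hy : Continuous y) (n : ℕ) :
    IsLocallyConstant fun x => res (y x) n := by
  induction n with
  | zero => exact IsLocallyConstant.const []
  | succ n ih => exact (hy.isLocallyConstant_apply n).comp₂ ih List.cons

theorem Continuous.isLocallyConstant_apply' {y : X → NN} (hy : Continuous y) {g : X → ℕ}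
    (hg : IsLocallyConstant g) : IsLocallyConstant fun x => y x (g x) :=
  isLocallyConstant_of_eventually fun x => by
    filter_upwards [hg.eventually x, (hy.isLocallyConstant_apply (g x)).eventually x]
      with x' h1 h2
    rw [h1, h2]

end locallyConstant

/-- `u` is an initial segment of a witness, up to changing `s` beyond the length of `u`. -/
def Approx (s : NN) (u : List ℕ) : Prop :=
  ∃ p : NN × NN, Witness p.1 p.2 ∧ res p.1 u.length = res s u.length ∧ res p.2 u.length = u

theorem Witness.approx {s v : NN} (h : Witness s v) (m : ℕ) : Approx s (res v m) :=
  ⟨(s, v), h, rfl, by rw [res_length]⟩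

theorem approx_congr {s s' : NN} {u : List ℕ} (h : res s u.length = res s' u.length) :
    Approx s u = Approx s' u := by
  simp only [Approx, h]

theorem isLocallyConstant_approx {X : Type*} [TopologicalSpace X] {s : X → NN} {u : X → List ℕ}
    (hs : Continuous s) (hu : IsLocallyConstant u) :
    IsLocallyConstant fun x => Approx (s x) (u x) :=
  isLocallyConstant_of_eventually fun x => by
    filter_upwards [hu.eventually x, (hs.isLocallyConstant_res (u x).length).eventually x]
      with x' h1 h2
    rw [h1, approx_congr h2]

theorem tendsto_of_res_eq {a : ℕ → NN} {b : NN} (h : ∀ m, res (a m) (m + 1) = res b (m + 1)) :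
    Tendsto a atTop (𝓝 b) := by
  refine tendsto_pi_nhds.2 fun i => tendsto_nhds_of_eventually_eq ?_
  filter_upwards [eventually_ge_atTop i] with m hm
  exact res_eq_res.1 (h m) (Nat.lt_succ_of_le hm)

theorem witness_of_approx {s v : NN} (h : ∀ m, Approx s (res v (m + 1))) : Witness s v := by
  choose p hp h1 h2 using h
  simp only [res_length] at h1 h2
  exact isClosed_witness.mem_of_tendsto
    ((tendsto_of_res_eq h1).prodMk_nhds (tendsto_of_res_eq h2)) (Eventually.of_forall hp)

/-- The tree of attempts to show that `y` is in the projection of the closed set coded by `w`. -/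
def InTree (w y : NN) : List ℕ → Prop
  | [] => True
  | a :: t => InTree w y t ∧ w (Encodable.encode (res y (t.length + 1), a :: t)) = 0

/-- The answers of the strategy `p`, with first move `n`, along `t`. -/
def play (p : List ℕ → ℕ) (n : ℕ) : List ℕ → List ℕ
  | [] => [n]
  | a :: t => p (a :: t) :: play p n t

@[simp] theorem length_play (p : List ℕ → ℕ) (n : ℕ) (t : List ℕ) :
    (play p n t).length = t.length + 1 := by
  induction t with
  | nil => rfl
  | cons a t ih => simp [play, ih]

/-- The strategy coded by `v`. -/
def strat (v : NN) : List ℕ → ℕ := fun t => v (2 * Encodable.encode t + 2)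

/-- The parameter coded by `v`. -/
def param (v : NN) : NN := fun i => v (2 * i + 1)

/-- `v` codes a parameter `y` and a strategy turning nodes of the tree of `y` into
initial segments of witnesses. -/
def Winning (w s v : NN) : Prop :=
  ∀ t, InTree w (param v) t → Approx s (play (strat v) (v 0) t)

theorem isLocallyConstant_inTree {X : Type*} [TopologicalSpace X] {w y : X → NN}
    (hw : Continuous w) (hy : Continuous y) (t : List ℕ) :
    IsLocallyConstant fun x => InTree (w x) (y x) t := by
  induction t with
  | nil => exact IsLocallyConstant.const True
  | cons a t ih =>
    have h := hw.isLocallyConstant_apply' ((hy.isLocallyConstant_res (t.length + 1)).comp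
      fun l => Encodable.encode (l, a :: t))
    exact ih.comp₂ (h.comp fun k => k = 0) And

theorem isLocallyConstant_play {X : Type*} [TopologicalSpace X] {p : X → List ℕ → ℕ} {n : X → ℕ}
    (hp : ∀ t, IsLocallyConstant fun x => p x t) (hn : IsLocallyConstant n) (t : List ℕ) :
    IsLocallyConstant fun x => play (p x) (n x) t := by
  induction t with
  | nil => exact hn.comp fun k => [k]
  | cons a t ih => exact (hp (a :: t)).comp₂ ih List.cons

theorem isClosed_winning {X : Type*} [TopologicalSpace X] {w s v : X → NN}
    (hw : Continuous w) (hs : Continuous s) (hv : Continuous v) :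
    IsClosed {x | Winning (w x) (s x) (v x)} := by
  refine isClosed_forall fun t => IsLocallyConstant.isClosed_setOf ?_
  refine (isLocallyConstant_inTree hw ?_ t).comp₂ (isLocallyConstant_approx hs
    (isLocallyConstant_play (fun t => ?_) (hv.isLocallyConstant_apply 0) t)) fun a b => a → b
  · unfold param
    fun_prop
  · exact hv.isLocallyConstant_apply _

/-- The set of all `(w, s, x)` such that `x` does not dominate a winning code. -/
def hardSet : Set (NN × (NN × IncSeq)) :=
  {q | ¬ ∃ v : NN, (∀ i, v i < q.2.2.1 i) ∧ Winning q.1 q.2.1 v}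

instance : SecondCountableTopology IncSeq :=
  TopologicalSpace.Subtype.secondCountableTopology {x : NN | StrictMono x}

theorem isOpen_hardSet : IsOpen hardSet := by
  have hC : IsClosed {q : (NN × (NN × IncSeq)) × NN |
      (∀ i, q.2 i < q.1.2.2.1 i) ∧ Winning q.1.1 q.1.2.1 q.2} := by
    refine isClosed_and (isClosed_forall fun i => ?_) (isClosed_winning ?_ ?_ ?_)
    · exact isClosed_of_discrete
        (f := fun q : (NN × (NN × IncSeq)) × NN => (q.2 i, q.1.2.2.1 i))
        (((continuous_apply i).comp continuous_snd).prodMk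
          ((continuous_apply i).comp (continuous_subtype_val.comp (by fun_prop))))
        fun d => d.1 < d.2
    all_goals fun_prop
  refine isClosed_compl_iff.1 (IsSeqClosed.isClosed fun q q₀ hq hlim => ?_)
  have hq' : ∀ k, ∃ v : NN, (∀ i, v i < (q k).2.2.1 i) ∧ Winning (q k).1 (q k).2.1 v :=
    fun k => not_not.1 (hq k)
  choose v hv hw using hq'
  have hbdd : ∀ i, ∃ M, ∀ k, (q k).2.2.1 i ≤ M := by
    intro i
    have hc : Continuous fun p : NN × (NN × IncSeq) => p.2.2.1 i :=
      (continuous_apply i).comp (continuous_subtype_val.comp (by fun_prop))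
    obtain ⟨M, hM⟩ := ((hc.tendsto q₀).comp hlim).bddAbove_range
    exact ⟨M, fun k => hM ⟨k, rfl⟩⟩
  choose M hM using hbdd
  have hcomp : IsCompact (Set.univ.pi fun i => Set.Iic (M i)) :=
    isCompact_univ_pi fun i => (Set.finite_Iic (M i)).isCompact
  obtain ⟨v₀, -, φ, hφ, hv₀⟩ := hcomp.tendsto_subseq
    (x := v) fun k i _ => (hv k i).le.trans (hM i k)
  have := hC.mem_of_tendsto ((hlim.comp hφ.tendsto_atTop).prodMk_nhds hv₀)
    (Eventually.of_forall fun k => ⟨hv (φ k), hw (φ k)⟩)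
  exact not_not.2 ⟨v₀, this⟩

/-! ### A complete set -/

/-- `y` and `b` form a branch of the tree coded by `w`. -/
def IsBranch (w y b : NN) : Prop :=
  ∀ m, w (Encodable.encode (res y (m + 1), res b (m + 1))) = 0

/-- The set of codes of trees some section of which is well-founded. -/
def sectionSet : Set NN := {w | ∃ y, ¬ ∃ b, IsBranch w y b}

theorem IsSigma12.exists_reduction {Z : Type} [TopologicalSpace Z] [PolishSpace Z]
    [MeasurableSpace Z] [BorelSpace Z] {A : Set Z} (hA : IsSigma12 A) :
    ∃ f : Z → NN, Measurable f ∧ ∀ z, z ∈ A ↔ f z ∈ sectionSet := by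
  classical
  obtain ⟨C, hC, rfl⟩ := hA
  rw [IsCoanalytic, AnalyticSet] at hC
  rcases hC with hC | ⟨g, hg, hgC⟩
  · refine ⟨fun _ _ => 1, measurable_const, fun z => iff_of_true ?_ ?_⟩
    · rw [compl_empty_iff.1 hC]
      exact ⟨(z, fun _ => 0), trivial, rfl⟩
    · exact ⟨fun _ => 0, fun ⟨b, hb⟩ => one_ne_zero (hb 0)⟩
  let D : List ℕ × List ℕ → Set Z := fun q =>
    closure {z | ∃ b, res b q.2.length = q.2 ∧ res (g b).2 q.1.length = q.1 ∧ (g b).1 = z}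
  let f : Z → NN := fun z j => if z ∈ D (Denumerable.ofNat _ j) then 0 else 1
  have hf : ∀ z q, f z (Encodable.encode q) = 0 ↔ z ∈ D q := fun z q => by
    simp only [f, Denumerable.ofNat_encode]
    simp
  refine ⟨f, measurable_pi_iff.2 fun j =>
    Measurable.ite isClosed_closure.measurableSet measurable_const measurable_const, fun z => ?_⟩
  have key : ∀ y, (z, y) ∈ range g ↔ ∃ b, IsBranch (f z) y b := by
    intro y
    constructor
    · rintro ⟨b, hb⟩
      refine ⟨b, fun m => (hf _ _).2 (subset_closure ⟨b, ?_, ?_, ?_⟩)⟩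
      · simp only [res_length]
      · simp only [res_length, hb]
      · rw [hb]
    · rintro ⟨b, hb⟩
      let _ := TopologicalSpace.metrizableSpaceMetric Z
      have h : ∀ m : ℕ, ∃ b', res b' (m + 1) = res b (m + 1) ∧
          res (g b').2 (m + 1) = res y (m + 1) ∧ dist (g b').1 z < 1 / ((m : ℝ) + 1) := by
        intro m
        obtain ⟨_, ⟨b', h1, h2, rfl⟩, h3⟩ := Metric.mem_closure_iff.1 ((hf _ _).1 (hb m))
          (1 / ((m : ℝ) + 1)) (by positivity)
        simp only [res_length] at h1 h2
        exact ⟨b', h1, h2, by rwa [dist_comm]⟩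
      choose b' h1 h2 h3 using h
      refine ⟨b, tendsto_nhds_unique ((hg.tendsto b).comp (tendsto_of_res_eq h1)) ?_⟩
      have h4 : Tendsto (fun m => (g (b' m)).1) atTop (𝓝 z) :=
        tendsto_iff_dist_tendsto_zero.2 (squeeze_zero (fun _ => dist_nonneg)
          (fun m => (h3 m).le) tendsto_one_div_add_atTop_nhds_zero_nat)
      exact h4.prodMk_nhds (tendsto_of_res_eq h2)
  constructor
  · rintro ⟨⟨z', y⟩, hy, rfl⟩
    refine ⟨y, fun h => ?_⟩
    have := (key y).2 h
    rw [hgC] at this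
    exact this hy
  · rintro ⟨y, hy⟩
    refine ⟨(z, y), ?_, rfl⟩
    by_contra hcon
    refine hy ((key y).1 ?_)
    rw [hgC]
    exact hcon

/-! ### No finite coloring when every section has a branch -/

theorem isBranch_inTree {w y b : NN} (h : IsBranch w y b) (m : ℕ) : InTree w y (res b m) := by
  induction m with
  | zero => trivial
  | succ m ih =>
    refine ⟨ih, ?_⟩
    have := h m
    rwa [res_succ, ← res_succ y, res_length]

theorem Winning.exists_witness {w s v b : NN} (h : Winning w s v)
    (hb : IsBranch w (param v) b) : ∃ u, Witness s u ∧ u 0 = v 0 := by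
  let u : NN := fun k => Nat.casesOn k (v 0) fun m => strat v (res b (m + 1))
  have hu : ∀ m, play (strat v) (v 0) (res b m) = res u (m + 1) := by
    intro m
    induction m with
    | zero => rfl
    | succ m ih => rw [res_succ, play, ih, res_succ u (m + 1)]; rfl
  exact ⟨u, witness_of_approx fun m => hu m ▸ h _ (isBranch_inTree hb m), rfl⟩

theorem BorelTerm.represents_sub {n : ℕ} {C : ℕ → BorelTerm} {v : NN}
    (h : MonoEdge ((nor C).code n) v) {i : ℕ} (hi : i < n) :
    (C i).Holds (interleave ((nor C).code n) (seqPart v)) ↔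
      (C i).Holds (interleave ((nor C).code n) (dropFirst (seqPart v))) := by
  have h1 := h.2.2.1.eq_zero_iff [i]
  have h2 := h.2.2.2.1.eq_zero_iff [i]
  have h3 := h.2.2.2.2 i hi
  rw [h1, h2] at h3
  exact h3

theorem not_hColoringLE {w : NN} (hw : w ∉ sectionSet) (n : ℕ) :
    ¬ HColoringLE {p : NN × IncSeq | (w, p) ∈ hardSet} n := by
  set D : Set (NN × IncSeq) := {p | (w, p) ∈ hardSet}
  rintro ⟨c, hc, hcol⟩
  have hDm : MeasurableSet D := by
    have : BorelSpace IncSeq := Subtype.borelSpace {x : NN | StrictMono x}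
    exact (isOpen_hardSet.preimage (by fun_prop : Continuous fun p : NN × IncSeq =>
      (w, p))).measurableSet
  have hrep : ∀ i : ℕ, ∃ b : BorelTerm,
      b.Represents (Subtype.val '' {p : D | (c p : ℕ) = i}) := fun i => by
    refine BorelTerm.exists_represents (MeasurableSet.subtype_image hDm ?_)
    exact measurableSet_eq_fun (measurable_from_top.comp hc) measurable_const
  choose C hC using hrep
  set s : NN := (BorelTerm.nor C).code n with hs
  have hne : ∃ k, ∃ v, Witness s v ∧ v 0 = k := by
    obtain ⟨v, hv⟩ := exists_witness s
    exact ⟨_, v, hv, rfl⟩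
  classical
  obtain ⟨v, hv, hv0⟩ := Nat.find_spec hne
  have hmin : ∀ u, Witness s u → v 0 ≤ u 0 := fun u hu => by
    rw [hv0]
    exact Nat.find_min' hne ⟨u, hu, rfl⟩
  have hedge : MonoEdge s v := BorelTerm.monoEdge_of_witness hv
  have hmono : StrictMono (seqPart v) := strictMono_nat_of_lt_succ hedge.2.1
  have hmem : ∀ q : IncSeq, q.1 0 ≤ v 0 → (s, q) ∈ D := by
    rintro q hq ⟨v', hlt, hwin⟩
    obtain ⟨b, hb⟩ : ∃ b, IsBranch w (param v') b := by
      by_contra hcon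
      exact hw ⟨_, hcon⟩
    obtain ⟨u, hu, hu0⟩ := hwin.exists_witness hb
    have := hmin u hu
    have := hlt 0
    simp only at this
    omega
  have hv1 : v 0 = seqPart v 1 := hedge.1
  let x : IncSeq := ⟨seqPart v, hmono⟩
  have hx : (s, x) ∈ D := hmem x (hv1 ▸ (hmono zero_lt_one).le)
  have hSx : (s, shift x) ∈ D := hmem _ (hv1 ▸ le_rfl)
  have hadj : HEdge (s, x) (s, shift x) := by
    refine ⟨rfl, fun h => ?_, Or.inl rfl⟩
    have : seqPart v 0 = seqPart v 1 := congrFun (congrArg Subtype.val h) 0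
    exact (hmono zero_lt_one).ne this
  refine hcol ⟨_, hx⟩ ⟨_, hSx⟩ hadj ?_
  have h1 := (hC (c ⟨_, hx⟩) (s, x)).1 ⟨⟨_, hx⟩, rfl, rfl⟩
  have h2 := (BorelTerm.represents_sub hedge (c ⟨_, hx⟩).2).1 h1
  obtain ⟨p, hp, hp'⟩ := (hC (c ⟨_, hx⟩) (s, shift x)).2 h2
  have : p = ⟨_, hSx⟩ := Subtype.ext hp'
  rw [this] at hp
  exact (Fin.ext hp).symm

/-! ### A finite coloring when some section is well-founded -/

theorem measurableSet_sInf_eq {X : Type*} [MeasurableSpace X] {P : X → ℕ → Prop}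
    (hP : ∀ m, MeasurableSet {x | P x m}) (k : ℕ) : MeasurableSet {x | sInf {m | P x m} = k} := by
  have key : {x | sInf {m | P x m} = k} =
      ({x | P x k} ∩ ⋂ j, ⋂ _ : j < k, {x | P x j}ᶜ) ∪ ({_x | k = 0} ∩ ⋂ j, {x | P x j}ᶜ) := by
    ext x
    simp only [mem_union, mem_inter_iff, mem_iInter, mem_compl_iff, mem_ofPred_eq]
    constructor
    · intro h
      by_cases hne : {m | P x m}.Nonempty
      · refine Or.inl ⟨h ▸ Nat.sInf_mem hne, fun j hj hPj => ?_⟩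
        exact (Nat.sInf_le (s := {m | P x m}) hPj).not_gt (h ▸ hj)
      · rw [not_nonempty_iff_eq_empty] at hne
        rw [hne, Nat.sInf_empty] at h
        exact Or.inr ⟨h.symm, fun j hj => (hne ▸ hj : j ∈ (∅ : Set ℕ))⟩
    · rintro (⟨h1, h2⟩ | ⟨h1, h2⟩)
      · refine le_antisymm (Nat.sInf_le h1) (le_of_not_gt fun hlt => ?_)
        exact h2 _ hlt (Nat.sInf_mem (s := {m | P x m}) ⟨k, h1⟩)
      · rw [h1, show {m | P x m} = ∅ from eq_empty_of_forall_notMem h2, Nat.sInf_empty]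
  rw [key]
  exact ((hP k).inter (MeasurableSet.iInter fun j => MeasurableSet.iInter fun _ =>
    (hP j).compl)).union ((MeasurableSet.const _).inter (MeasurableSet.iInter fun j => (hP j).compl))

theorem measurable_sInf_setOf {X : Type*} [MeasurableSpace X] {P : X → ℕ → Prop}
    (hP : ∀ m, MeasurableSet {x | P x m}) : Measurable fun x => sInf {m | P x m} :=
  measurable_to_countable' fun k => measurableSet_sInf_eq hP k

theorem wellFounded_inTree {w y : NN} (h : ¬ ∃ b, IsBranch w y b) :
    WellFounded fun t' t : List ℕ => (∃ a, t' = a :: t) ∧ InTree w y t' := by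
  set r := fun t' t : List ℕ => (∃ a, t' = a :: t) ∧ InTree w y t'
  have hnil : Acc r [] := by
    by_contra hcon
    have hstep : ∀ t, ∃ a, ¬ Acc r t → InTree w y (a :: t) ∧ ¬ Acc r (a :: t) := by
      intro t
      by_cases ht : Acc r t
      · exact ⟨0, fun h => absurd ht h⟩
      · by_contra hno
        refine ht ⟨_, ?_⟩
        rintro _ ⟨⟨a, rfl⟩, ha⟩
        by_contra hacc
        exact hno ⟨a, fun _ => ⟨ha, hacc⟩⟩
    choose g hg using hstep
    let l : ℕ → List ℕ := fun k => Nat.rec [] (fun _ t => g t :: t) k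
    have hl : ∀ k, res (fun k => g (l k)) k = l k := by
      intro k
      induction k with
      | zero => rfl
      | succ k ih => rw [res_succ, ih]
    have hacc : ∀ k, ¬ Acc r (l k) := by
      intro k
      induction k with
      | zero => exact hcon
      | succ k ih => exact (hg _ ih).2
    refine h ⟨fun k => g (l k), fun m => ?_⟩
    have h1 : InTree w y (g (l m) :: l m) := (hg _ (hacc m)).1
    rw [res_succ (fun k => g (l k)), hl]
    have h2 := h1.2
    rwa [← hl, res_length, hl] at h2
  refine ⟨fun t => ?_⟩
  induction t with
  | nil => exact hnil
  | cons a t ih =>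
    by_cases hat : InTree w y (a :: t)
    · exact ih.inv ⟨⟨a, rfl⟩, hat⟩
    · refine ⟨_, ?_⟩
      rintro _ ⟨⟨b, rfl⟩, hb⟩
      exact absurd hb.1 hat

theorem exists_winning_positions {w y : NN} (h : ¬ ∃ b, IsBranch w y b) :
    ∃ E : List ℕ → List ℕ → Set NN, (∀ t u, MeasurableSet (E t u)) ∧
      ∀ t u s, s ∈ E t u ↔
        Approx s u ∧ ∀ a, InTree w y (a :: t) → ∃ m, s ∈ E (a :: t) (m :: u) := by
  have hwf := wellFounded_inTree h
  have happ : ∀ u, MeasurableSet {s | Approx s u} := fun u =>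
    (isLocallyConstant_approx continuous_id (IsLocallyConstant.const u)).isClosed_setOf.measurableSet
  let step : ∀ t, (∀ t', ((∃ a, t' = a :: t) ∧ InTree w y t') →
      List ℕ → {A : Set NN // MeasurableSet A}) → List ℕ → {A : Set NN // MeasurableSet A} :=
    fun t ih u => ⟨{s | Approx s u} ∩ ⋂ a, ⋂ ha : InTree w y (a :: t),
      ⋃ m, (ih (a :: t) ⟨⟨a, rfl⟩, ha⟩ (m :: u)).1,
      (happ u).inter (MeasurableSet.iInter fun a => MeasurableSet.iInter fun ha =>
        MeasurableSet.iUnion fun m => (ih (a :: t) ⟨⟨a, rfl⟩, ha⟩ (m :: u)).2)⟩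
  let E : List ℕ → List ℕ → {A : Set NN // MeasurableSet A} := hwf.fix step
  have hE : ∀ t, E t = step t fun t' _ => E t' := fun t => hwf.fix_eq step t
  refine ⟨fun t u => (E t u).1, fun t u => (E t u).2, fun t u s => ?_⟩
  have h1 : s ∈ (E t u).1 ↔ s ∈ (step t (fun t' _ => E t') u).1 := by rw [hE t]
  refine h1.trans ?_
  simp [step]

theorem exists_measurable_winning {w : NN} (hw : w ∈ sectionSet) :
    ∃ V : NN → NN, Measurable V ∧ ∀ s, Winning w s (V s) := by
  obtain ⟨y, hy⟩ := hw
  obtain ⟨E, hEm, hE⟩ := exists_winning_positions hy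
  have hwit : ∀ s v, Witness s v → ∀ t, s ∈ E t (res v (t.length + 1)) := by
    intro s v hv t
    induction t using (wellFounded_inTree hy).induction with
    | _ t ih =>
      exact (hE _ _ _).2 ⟨hv.approx _, fun a ha => ⟨_, ih (a :: t) ⟨⟨a, rfl⟩, ha⟩⟩⟩
  let pl : NN → List ℕ → List ℕ := fun s t =>
    List.rec [sInf {n | s ∈ E [] [n]}] (fun a t l => sInf {m | s ∈ E (a :: t) (m :: l)} :: l) t
  have hplm : ∀ t l, MeasurableSet {s | pl s t = l} := by
    intro t
    induction t with
    | nil =>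
      intro l
      by_cases hl : ∃ k, l = [k]
      · obtain ⟨k, rfl⟩ := hl
        convert measurableSet_sInf_eq (fun n => hEm [] [n]) k using 1
        ext s
        exact ⟨fun h => (List.cons.inj h).1, fun h => congrArg (fun j => [j]) h⟩
      · convert MeasurableSet.empty
        exact eq_empty_of_forall_notMem fun s hs => hl ⟨_, hs.symm⟩
    | cons a t ih =>
      intro l
      cases l with
      | nil =>
        convert MeasurableSet.empty
        exact eq_empty_of_forall_notMem fun s hs => List.cons_ne_nil _ _ hs
      | cons k l =>
        convert (ih l).inter (measurableSet_sInf_eq (fun m => hEm (a :: t) (m :: l)) k) using 1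
        ext s
        change _ :: pl s t = _ ↔ pl s t = l ∧ _
        rw [List.cons.injEq, and_comm]
        refine and_congr_right fun h => ?_
        rw [← h]
        rfl
  let V : NN → NN := fun s k => if k = 0 then (pl s []).headI else if k % 2 = 1 then y (k / 2) else
    (pl s (Denumerable.ofNat (List ℕ) (k / 2 - 1))).headI
  have hpar : ∀ s, param (V s) = y := by
    intro s
    funext i
    have a : (2 * i + 1) % 2 = 1 := by omega
    have b : (2 * i + 1) / 2 = i := by omega
    simp [param, V, a, b]
  have hstrat : ∀ s t, strat (V s) t = (pl s t).headI := by
    intro s t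
    have a : (2 * Encodable.encode t + 2) % 2 = 0 := by omega
    have b : (2 * Encodable.encode t + 2) / 2 - 1 = Encodable.encode t := by omega
    simp [strat, V, a]
  have hplay : ∀ s t, play (strat (V s)) (V s 0) t = pl s t := by
    intro s t
    induction t with
    | nil => rfl
    | cons a t ih => rw [play, hstrat, ih]; rfl
  have hwin : ∀ s t, InTree w y t → s ∈ E t (pl s t) := by
    intro s t
    induction t with
    | nil =>
      intro _
      obtain ⟨v, hv⟩ := exists_witness s
      exact Nat.sInf_mem (s := {n | s ∈ E [] [n]}) ⟨_, hwit s v hv []⟩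
    | cons a t ih =>
      intro hat
      exact Nat.sInf_mem (s := {m | s ∈ E (a :: t) (m :: pl s t)})
        (((hE _ _ _).1 (ih hat.1)).2 a hat)
  refine ⟨V, measurable_pi_iff.2 fun k => ?_, fun s t ht => ?_⟩
  · have hhead : ∀ t, Measurable fun s => (pl s t).headI := by
      intro t
      refine measurable_to_countable' fun k => ?_
      have : (fun s => (pl s t).headI) ⁻¹' {k} =
          ⋃ l : {l : List ℕ // l.headI = k}, {s | pl s t = l.1} := by
        ext s
        simp
      rw [this]
      exact MeasurableSet.iUnion fun l => hplm t l.1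
    simp only [V]
    split_ifs
    · exact hhead []
    · exact measurable_const
    · exact hhead (Denumerable.ofNat (List ℕ) (k / 2 - 1))
  · rw [hpar] at ht
    rw [hplay]
    exact ((hE _ _ _).1 (hwin s t ht)).1

/-- The index of the interval of the partition of `ℕ` determined by `g` containing `m`. -/
noncomputable def block (g : NN) (m : ℕ) : ℕ := sInf {j | m ≤ g j ∨ m ≤ j}

theorem block_spec (g : NN) (m : ℕ) : m ≤ g (block g m) ∨ m ≤ block g m :=
  Nat.sInf_mem (s := {j | m ≤ g j ∨ m ≤ j}) ⟨m, Or.inr le_rfl⟩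

theorem block_le {g : NN} {m j : ℕ} (h : m ≤ g j) : block g m ≤ j :=
  Nat.sInf_le (Or.inl h)

theorem block_mono (g : NN) : Monotone (block g) := fun _ m' h =>
  Nat.sInf_le ((block_spec g m').imp h.trans h.trans)

/-- Whether the first two elements of a set lie in the same block. -/
def SameBlock (q : NN × NN) : Prop := block q.1 (q.2 0) = block q.1 (q.2 1)

/-- Removing the first `k` entries of the second coordinate. -/
def dropSnd (k : ℕ) (q : NN × NN) : NN × NN := (q.1, fun n => q.2 (n + k))

/-- The first time at which the truth value of `SameBlock` changes along the shift orbit. -/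
noncomputable def changeTime (q : NN × NN) : ℕ :=
  sInf {k | ¬ (SameBlock (dropSnd k q) ↔ SameBlock q)}

open Classical in
/-- A coloring of the shift graph off the set of sequences dominating the first coordinate. -/
noncomputable def blockColor (q : NN × NN) : ℕ :=
  (if SameBlock q then 2 else 0) + changeTime q % 2

theorem blockColor_lt (q : NN × NN) : blockColor q < 4 := by
  unfold blockColor
  split_ifs <;> omega

theorem measurable_block (i : ℕ) : Measurable fun q : NN × NN => block q.1 (q.2 i) := by
  have h : ∀ j, Measurable fun q : NN × NN => q.1 j := fun j =>
    (measurable_pi_apply j).comp measurable_fst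
  have h' : Measurable fun q : NN × NN => q.2 i := (measurable_pi_apply i).comp measurable_snd
  exact measurable_sInf_setOf fun j =>
    (measurableSet_le h' (h j)).union (measurableSet_le h' measurable_const)

theorem measurableSet_sameBlock : MeasurableSet {q | SameBlock q} :=
  measurableSet_eq_fun (measurable_block 0) (measurable_block 1)

theorem measurable_dropSnd (k : ℕ) : Measurable (dropSnd k) :=
  measurable_fst.prodMk (measurable_pi_iff.2 fun n =>
    (measurable_pi_apply (n + k)).comp measurable_snd)

theorem measurable_changeTime : Measurable changeTime := by
  refine measurable_sInf_setOf fun k => MeasurableSet.compl ?_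
  have h1 := measurable_dropSnd k measurableSet_sameBlock
  have h2 := measurableSet_sameBlock
  have h3 : {q | SameBlock (dropSnd k q) ↔ SameBlock q} =
      dropSnd k ⁻¹' {q | SameBlock q} ∩ {q | SameBlock q} ∪
        (dropSnd k ⁻¹' {q | SameBlock q})ᶜ ∩ {q | SameBlock q}ᶜ := by
    ext q
    simp only [mem_ofPred_eq, mem_union, mem_inter_iff, mem_preimage, mem_compl_iff]
    tauto
  have h4 : MeasurableSet {q | SameBlock (dropSnd k q) ↔ SameBlock q} := by
    rw [h3]
    exact (h1.inter h2).union (h1.compl.inter h2.compl)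
  exact h4

theorem measurable_blockColor : Measurable blockColor := by
  classical
  have : Measurable fun q => changeTime q % 2 :=
    (measurable_from_top (f := fun k : ℕ => k % 2)).comp measurable_changeTime
  exact (Measurable.ite measurableSet_sameBlock measurable_const measurable_const).add this

theorem blockColor_ne {g x : NN} (hx : StrictMono x) (h : ¬ ∀ i, g i < x (i + 1)) :
    blockColor (g, x) ≠ blockColor (g, dropFirst x) := by
  classical
  have hex : {k | ¬ (SameBlock (dropSnd k (g, x)) ↔ SameBlock (g, x))}.Nonempty := by
    by_contra hcon
    have hall : ∀ k, SameBlock (dropSnd k (g, x)) ↔ SameBlock (g, x) := fun k => by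
      by_contra hk
      exact hcon ⟨k, hk⟩
    have hsame : ∀ k, SameBlock (dropSnd k (g, x)) ↔ block g (x k) = block g (x (k + 1)) :=
      fun k => by simp [SameBlock, dropSnd, add_comm]
    by_cases h0 : SameBlock (g, x)
    · have heq : ∀ k, block g (x k) = block g (x 0) := by
        intro k
        induction k with
        | zero => rfl
        | succ k ih => rw [← ih, (hsame k).1 ((hall k).2 h0)]
      have hspec := block_spec g (x (g (block g (x 0)) + block g (x 0) + 1))
      rw [heq (g (block g (x 0)) + block g (x 0) + 1)] at hspec
      have := hx.le_apply (x := g (block g (x 0)) + block g (x 0) + 1)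
      omega
    · have hlt : ∀ k, block g (x k) < block g (x (k + 1)) := fun k =>
        lt_of_le_of_ne (block_mono g (hx k.lt_succ_self).le) fun he =>
          h0 ((hall k).1 ((hsame k).2 he))
      have hge : ∀ k, k ≤ block g (x k) := fun k => (strictMono_nat_of_lt_succ hlt).le_apply
      push Not at h
      obtain ⟨i, hi⟩ := h
      have := block_le hi
      have := hge (i + 1)
      omega
  intro heq
  have hiff : SameBlock (g, x) ↔ SameBlock (g, dropFirst x) := by
    unfold blockColor at heq
    split_ifs at heq <;> first | tauto | omega
  have hdrop : ∀ k, dropSnd k (g, dropFirst x) = dropSnd (k + 1) (g, x) := fun k => by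
    simp only [dropSnd, dropFirst, add_assoc]
  have hmem : ¬ (SameBlock (dropSnd (changeTime (g, x)) (g, x)) ↔ SameBlock (g, x)) :=
    Nat.sInf_mem hex
  have hpos : changeTime (g, x) ≠ 0 := fun h0 => by
    rw [h0] at hmem
    exact hmem Iff.rfl
  have hsucc : changeTime (g, x) = changeTime (g, dropFirst x) + 1 := by
    have hset : ∀ k, ¬ (SameBlock (dropSnd k (g, dropFirst x)) ↔ SameBlock (g, dropFirst x)) ↔
        ¬ (SameBlock (dropSnd (k + 1) (g, x)) ↔ SameBlock (g, x)) := fun k => by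
      rw [hdrop, hiff]
    obtain ⟨k, hk⟩ := Nat.exists_eq_succ_of_ne_zero hpos
    have hk' : ¬ (SameBlock (dropSnd k (g, dropFirst x)) ↔ SameBlock (g, dropFirst x)) := by
      rw [hset]
      rw [hk] at hmem
      exact hmem
    refine le_antisymm (Nat.sInf_le ?_) ?_
    · exact (hset _).1 (Nat.sInf_mem
        (s := {k | ¬ (SameBlock (dropSnd k (g, dropFirst x)) ↔ SameBlock (g, dropFirst x))})
        ⟨k, hk'⟩)
    · rw [hk]
      exact Nat.succ_le_succ (Nat.sInf_le hk')
  unfold blockColor at heq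
  rw [hsucc] at heq
  simp only [hiff] at heq
  omega

theorem hColoringLE_four {w : NN} (hw : w ∈ sectionSet) :
    HColoringLE {p : NN × IncSeq | (w, p) ∈ hardSet} 4 := by
  obtain ⟨V, hV, hwin⟩ := exists_measurable_winning hw
  have hm : Measurable fun p : {p : NN × IncSeq | (w, p) ∈ hardSet} =>
      blockColor (V p.1.1, p.1.2.1) :=
    measurable_blockColor.comp ((hV.comp (measurable_fst.comp measurable_subtype_coe)).prodMk
      (measurable_subtype_coe.comp (measurable_snd.comp measurable_subtype_coe)))
  have hedge : ∀ s (x y : IncSeq), shift x = y → (w, (s, y)) ∈ hardSet →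
      blockColor (V s, x.1) ≠ blockColor (V s, y.1) := by
    rintro s x _ rfl hy
    exact blockColor_ne x.2 fun h => hy ⟨V s, h, hwin s⟩
  refine ⟨fun p => ⟨blockColor (V p.1.1, p.1.2.1), blockColor_lt _⟩, ?_, ?_⟩
  · refine measurable_to_countable' fun i => ?_
    convert hm (measurableSet_singleton i.1) using 1
    ext p
    simp [Fin.ext_iff]
  · rintro ⟨⟨s, x⟩, hx⟩ ⟨⟨s', y⟩, hy⟩ ⟨hs, -, hxy⟩ heq
    obtain rfl : s = s' := hs
    have heq' := congrArg Fin.val heq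
    rcases hxy with hxy | hxy
    · exact hedge s x y hxy hy heq'
    · exact hedge s y x hxy hx heq'.symm

/-- There is a `Π⁰₂` set `B ⊆ ℕ^ℕ × (ℕ^ℕ × [ℕ]^ℕ)` such that
`{s : χ_B(ℋ|_{B_s}) < ∞}` is `Σ¹₂`-hard. -/
theorem exists_Pi02_set_with_Sigma12_hard_H_sections :
    ∃ B : Set (NN × (NN × IncSeq)), IsPi02 B ∧
      Sigma12Hard {s : NN | ∃ n : ℕ, HColoringLE {p : NN × IncSeq | (s, p) ∈ B} n} := by
  refine ⟨hardSet, ⟨fun _ => hardSet, fun _ => isOpen_hardSet, (iInter_const _).symm⟩, ?_⟩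
  intro Z _ _ _ _ A hA
  obtain ⟨f, hf, hfA⟩ := hA.exists_reduction
  refine ⟨f, hf, fun z => (hfA z).trans ⟨fun h => ⟨4, hColoringLE_four h⟩, ?_⟩⟩
  rintro ⟨n, hn⟩
  by_contra hcon
  exact not_hColoringLE hcon n hn
end

section
/- Let F ⊆ ℕ^ℕ × [ℕ]^ℕ be a closed set. Then the set B = {(s,y) ∈ ℕ^ℕ × [ℕ]^ℕ : for all x ∈ [ℕ]^ℕ with x ≤* y, x ∉ F_s} is Π⁰₂ (a countable intersection of open sets). Indeed, for each eventually-zero σ ∈ ℕ^ℕ the set B'_σ = {(s,y) : ∃x ∈ [ℕ]^ℕ with x(n) ≤ y(n)+σ(n) for all n and x ∈ F_s} is closed, and the complement of B is the union of the sets B'_σ. -/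
open MeasureTheory Set

/-- `x ≤* y` : `x(n) ≤ y(n)` for all but finitely many `n`. -/
def leStar (x y : IncSeq) : Prop := ∃ N : ℕ, ∀ n : ℕ, N ≤ n → x.1 n ≤ y.1 n

/-- The set of points `(s, y)` such that some `x ∈ F_s` satisfies `x ≤ y + σ` is closed when `F`
is, because the sequences below a fixed bound form a compact set. -/
theorem isClosed_exists_le_add {F : Set (NN × IncSeq)} (hF : IsClosed F) (σ : NN) :
    IsClosed {p : NN × IncSeq |
      ∃ x : IncSeq, (∀ n : ℕ, x.1 n ≤ p.2.1 n + σ n) ∧ (p.1, x) ∈ F} := by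
  have : FirstCountableTopology IncSeq := Topology.IsInducing.subtypeVal.firstCountableTopology
  apply IsSeqClosed.isClosed
  intro p q hp hpq
  choose x hx hxF using hp
  have hp₁ : Filter.Tendsto (fun k => (p k).1) Filter.atTop (nhds q.1) :=
    (continuous_fst.tendsto q).comp hpq
  have hp₂ (n : ℕ) : Filter.Tendsto (fun k => (p k).2.1 n) Filter.atTop (nhds (q.2.1 n)) :=
    ((continuous_apply n).comp (continuous_subtype_val.comp continuous_snd)).tendsto q |>.comp hpq
  choose M hM using fun n => (hp₂ n).bddAbove_range
  have hK : IsCompact (Set.pi univ fun n => Set.Iic (M n + σ n)) :=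
    isCompact_univ_pi fun n => (Set.finite_Iic _).isCompact
  obtain ⟨z, -, φ, hφ, hz⟩ := hK.tendsto_subseq (x := fun k => (x k).1) fun k n _ =>
    (hx k n).trans (Nat.add_le_add_right (hM n ⟨k, rfl⟩) _)
  have hzn (n : ℕ) : Filter.Tendsto (fun k => (x (φ k)).1 n) Filter.atTop (nhds (z n)) :=
    (continuous_apply n).tendsto z |>.comp hz
  have hzmono : StrictMono z := strictMono_nat_of_lt_succ fun n =>
    Nat.succ_le_iff.1 <| le_of_tendsto_of_tendsto' ((hzn n).add_const 1) (hzn (n + 1))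
      fun k => (x (φ k)).2 n.lt_succ_self
  refine ⟨⟨z, hzmono⟩, fun n => ?_, ?_⟩
  · exact le_of_tendsto_of_tendsto' (hzn n)
      (((hp₂ n).comp hφ.tendsto_atTop).add_const (σ n)) fun k => hx (φ k) n
  · have hx' : Filter.Tendsto (fun k => x (φ k)) Filter.atTop (nhds (⟨z, hzmono⟩ : IncSeq)) :=
      tendsto_subtype_rng.2 hz
    exact hF.mem_of_tendsto ((hp₁.comp hφ.tendsto_atTop).prodMk_nhds hx')
      (Filter.Eventually.of_forall fun k => hxF (φ k))

/-- There are only countably many eventually zero sequences of natural numbers. -/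
theorem countable_eventually_zero :
    Countable {σ : NN // ∃ N : ℕ, ∀ n : ℕ, N ≤ n → σ n = 0} := by
  have hfin (σ : {σ : NN // ∃ N : ℕ, ∀ n : ℕ, N ≤ n → σ n = 0}) :
      (Function.support σ.1).Finite := by
    obtain ⟨σ, N, hN⟩ := σ
    exact (Set.finite_Iio N).subset fun n hn => not_le.1 fun h => hn (hN n h)
  refine Function.Injective.countable (f := fun σ => Finsupp.ofSupportFinite σ.1 (hfin σ)) ?_
  intro σ τ h
  exact Subtype.ext (congrArg (fun f : ℕ →₀ ℕ => (f : ℕ → ℕ)) h)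

/-- `x ≤* y` holds exactly when `x ≤ y + σ` for some eventually zero `σ`. -/
theorem leStar_iff_exists_le_add (x y : IncSeq) :
    leStar x y ↔ ∃ σ : {σ : NN // ∃ N : ℕ, ∀ n : ℕ, N ≤ n → σ n = 0},
      ∀ n : ℕ, x.1 n ≤ y.1 n + σ.1 n := by
  constructor
  · rintro ⟨N, hN⟩
    refine ⟨⟨fun n => if n < N then x.1 n else 0, N, fun n hn => if_neg hn.not_gt⟩, fun n => ?_⟩
    by_cases h : n < N
    · simp [h]
    · simpa [h] using hN n (not_lt.1 h)
  · rintro ⟨⟨σ, N, hN⟩, h⟩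
    exact ⟨N, fun n hn => by simpa [hN n hn] using h n⟩

/-- For closed `F ⊆ ℕ^ℕ × [ℕ]^ℕ`, the set
`B = {(s,y) : ∀ x ≤* y, x ∉ F_s}` is `Π⁰₂`; indeed for every eventually-zero `σ` the set
`B'_σ = {(s,y) : ∃ x ≤ y + σ, x ∈ F_s}` is closed, and `Bᶜ` is the union of the `B'_σ`. -/
theorem nondominating_section_set_is_Pi02 (F : Set (NN × IncSeq)) (hF : IsClosed F) :
    (∀ σ : NN, (∃ N : ℕ, ∀ n : ℕ, N ≤ n → σ n = 0) →
      IsClosed {p : NN × IncSeq |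
        ∃ x : IncSeq, (∀ n : ℕ, x.1 n ≤ p.2.1 n + σ n) ∧ (p.1, x) ∈ F}) ∧
    ({p : NN × IncSeq | ∀ x : IncSeq, leStar x p.2 → (p.1, x) ∉ F}ᶜ =
      ⋃ σ : {σ : NN // ∃ N : ℕ, ∀ n : ℕ, N ≤ n → σ n = 0},
        {p : NN × IncSeq |
          ∃ x : IncSeq, (∀ n : ℕ, x.1 n ≤ p.2.1 n + σ.1 n) ∧ (p.1, x) ∈ F}) ∧
    IsPi02 {p : NN × IncSeq | ∀ x : IncSeq, leStar x p.2 → (p.1, x) ∉ F} := by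
  have hcompl : {p : NN × IncSeq | ∀ x : IncSeq, leStar x p.2 → (p.1, x) ∉ F}ᶜ =
      ⋃ σ : {σ : NN // ∃ N : ℕ, ∀ n : ℕ, N ≤ n → σ n = 0},
        {p : NN × IncSeq |
          ∃ x : IncSeq, (∀ n : ℕ, x.1 n ≤ p.2.1 n + σ.1 n) ∧ (p.1, x) ∈ F} := by
    ext p
    simp only [leStar_iff_exists_le_add, mem_compl_iff, mem_ofPred_eq, mem_iUnion, not_forall,
      not_not, exists_prop]
    constructor
    · rintro ⟨x, ⟨σ, hσ⟩, hx⟩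
      exact ⟨σ, x, hσ, hx⟩
    · rintro ⟨σ, x, hσ, hx⟩
      exact ⟨x, ⟨σ, hσ⟩, hx⟩
  refine ⟨fun σ _ => isClosed_exists_le_add hF σ, hcompl, ?_⟩
  have := countable_eventually_zero
  have : Nonempty {σ : NN // ∃ N : ℕ, ∀ n : ℕ, N ≤ n → σ n = 0} := ⟨⟨0, 0, fun _ _ => rfl⟩⟩
  obtain ⟨e, he⟩ := exists_surjective_nat {σ : NN // ∃ N : ℕ, ∀ n : ℕ, N ≤ n → σ n = 0}
  refine ⟨fun n => {p : NN × IncSeq |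
    ∃ x : IncSeq, (∀ m : ℕ, x.1 m ≤ p.2.1 m + (e n).1 m) ∧ (p.1, x) ∈ F}ᶜ,
    fun n => (isClosed_exists_le_add hF (e n).1).isOpen_compl, ?_⟩
  rw [← compl_iUnion, he.iUnion_comp (fun σ => {p : NN × IncSeq |
    ∃ x : IncSeq, (∀ m : ℕ, x.1 m ≤ p.2.1 m + σ.1 m) ∧ (p.1, x) ∈ F}), ← hcompl, compl_compl]
end

section
/- For every Σ¹₁ (analytic) set A ⊆ ℕ^ℕ there exists a Π⁰₂ set B ⊆ ℕ^ℕ × [ℕ]^ℕ such that for every s ∈ ℕ^ℕ, s ∈ A if and only if the section B_s is not a dominating subset of [ℕ]^ℕ. Consequently, the collection of non-dominating Π⁰₂ subsets of [ℕ]^ℕ is Σ¹₁-hard in the codes. -/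
open MeasureTheory Set

/-- `S ⊆ [ℕ]^ℕ` is dominating: every `y` is eventually dominated by some member of `S`. -/
def Dominating (S : Set IncSeq) : Prop :=
  ∀ y : IncSeq, ∃ x ∈ S, ∃ N : ℕ, ∀ n : ℕ, N ≤ n → y.1 n ≤ x.1 n

/-- `A` is `Σ¹₁`-hard: every analytic subset of a Polish space Borel-reduces to `A`. -/
def Sigma11Hard {X : Type} [MeasurableSpace X] (A : Set X) : Prop :=
  ∀ (Z : Type) [TopologicalSpace Z] [PolishSpace Z] [MeasurableSpace Z] [BorelSpace Z],
    ∀ A' : Set Z, AnalyticSet A' → ∃ f : Z → X, Measurable f ∧ ∀ z, z ∈ A' ↔ f z ∈ A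

open Filter Topology

/-- The set of pairs `(s, x)` such that `x` eventually dominates no member of `F_s`. -/
def nonDominators (F : Set (NN × NN)) : Set (NN × IncSeq) :=
  {p | ¬ ∃ w, (p.1, w) ∈ F ∧ ∃ M, ∀ n, w n ≤ max (p.2.1 n) M}

/-- Projection of a closed set along fibers that are bounded by a locally constant bound. -/
theorem isClosed_exists_le_max {F : Set (NN × NN)} (hF : IsClosed F) (M : ℕ) :
    IsClosed {p : NN × IncSeq | ∃ w, (p.1, w) ∈ F ∧ ∀ n, w n ≤ max (p.2.1 n) M} := by
  rw [isClosed_iff_ultrafilter]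
  intro p u hu hmem
  have hmem' : ∀ᶠ q in (u : Filter (NN × IncSeq)),
      ∃ w, (q.1, w) ∈ F ∧ ∀ n, w n ≤ max (q.2.1 n) M := hmem
  obtain ⟨g, hg⟩ := hmem'.choice
  have hfst : Tendsto (fun q : NN × IncSeq => q.1) u (𝓝 p.1) :=
    (continuous_fst.tendsto p).mono_left hu
  have hx (n : ℕ) : ∀ᶠ q in (u : Filter (NN × IncSeq)), q.2.1 n = p.2.1 n := by
    have hc : Continuous fun q : NN × IncSeq => q.2.1 n :=
      (continuous_apply n).comp (continuous_subtype_val.comp continuous_snd)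
    have h := (hc.tendsto p).mono_left hu
    rwa [nhds_discrete, tendsto_pure] at h
  have hval (n : ℕ) : ∃ k ≤ max (p.2.1 n) M,
      ∀ᶠ q in (u : Filter (NN × IncSeq)), g q n = k := by
    have h : ∀ᶠ q in (u : Filter (NN × IncSeq)), ∃ k ∈ Set.Iic (max (p.2.1 n) M), g q n = k := by
      filter_upwards [hg, hx n] with q hq hqn
      exact ⟨_, hqn ▸ hq.2 n, rfl⟩
    exact (Ultrafilter.eventually_exists_mem_iff (Set.finite_Iic _)).1 h
  choose w hw hgw using hval
  refine ⟨w, ?_, hw⟩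
  have hlim : Tendsto g u (𝓝 w) := by
    rw [tendsto_pi_nhds]
    intro n
    rw [nhds_discrete, tendsto_pure]
    exact hgw n
  exact hF.mem_of_tendsto (hfst.prodMk_nhds hlim) (hg.mono fun q hq => hq.1)

theorem isPi02_nonDominators {F : Set (NN × NN)} (hF : IsClosed F) :
    IsPi02 (nonDominators F) := by
  refine ⟨_, fun M => (isClosed_exists_le_max hF M).isOpen_compl, ?_⟩
  ext p
  simp only [nonDominators, mem_ofPred_eq, mem_iInter, mem_compl_iff]
  constructor
  · rintro h M ⟨w, hw, hle⟩
    exact h ⟨w, hw, M, hle⟩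
  · rintro h ⟨w, hw, M, hle⟩
    exact h M ⟨w, hw, hle⟩

theorem exists_mem_iff_not_dominating (F : Set (NN × NN)) (s : NN) :
    (∃ w, (s, w) ∈ F) ↔ ¬ Dominating {x : IncSeq | (s, x) ∈ nonDominators F} := by
  constructor
  · rintro ⟨w, hw⟩ hdom
    have hy : StrictMono fun n => ∑ i ∈ Finset.range (n + 1), (w i + 1) := by
      refine strictMono_nat_of_lt_succ fun n => ?_
      rw [Finset.sum_range_succ _ (n + 1)]
      omega
    obtain ⟨x, hx, N, hN⟩ := hdom ⟨_, hy⟩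
    refine hx ⟨w, hw, ∑ i ∈ Finset.range N, w i, fun n => ?_⟩
    rcases lt_or_ge n N with h | h
    · exact le_max_of_le_right
        (Finset.single_le_sum (f := w) (fun _ _ => Nat.zero_le _) (Finset.mem_range.2 h))
    · refine le_max_of_le_left (le_trans ?_ (hN n h))
      change w n ≤ ∑ i ∈ Finset.range (n + 1), (w i + 1)
      rw [Finset.sum_range_succ]
      omega
  · intro h
    by_contra hne
    refine h fun y => ⟨y, ?_, 0, fun n _ => le_rfl⟩
    rintro ⟨w, hw, -⟩
    exact hne ⟨w, hw⟩

/-- The pairs `(s, w)` such that `s` vanishes at the code of every initial segment of `w`. -/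
def codedBranches : Set (NN × NN) :=
  {p | ∀ n, p.1 (Encodable.encode (PiNat.res p.2 n)) = 0}

theorem isClosed_codedBranches : IsClosed codedBranches := by
  have hres (n : ℕ) : Continuous fun w : NN => PiNat.res w n := by
    rw [continuous_iff_continuousAt]
    intro w
    refine continuousAt_const.congr (f := fun _ => PiNat.res w n) ?_
    have hopen := (PiNat.isOpen_cylinder (fun _ => ℕ) w n).mem_nhds (PiNat.self_mem_cylinder w n)
    filter_upwards [hopen] with v hv
    rw [PiNat.cylinder_eq_res] at hv
    exact hv.symm
  have heval : Continuous fun p : NN × ℕ => p.1 p.2 := by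
    rw [continuous_prod_of_discrete_right]
    exact fun m => continuous_apply m
  simp only [codedBranches, ofPred_forall]
  refine isClosed_iInter fun n => isClosed_eq ?_ continuous_const
  exact heval.comp (continuous_fst.prodMk
    ((continuous_of_discreteTopology (f := Encodable.encode)).comp ((hres n).comp continuous_snd)))

theorem sigma11Hard_exists_mem_codedBranches :
    Sigma11Hard {s : NN | ∃ w, (s, w) ∈ codedBranches} := by
  intro Z _ _ _ _ A hA
  rw [AnalyticSet] at hA
  rcases hA with rfl | ⟨g, hg, rfl⟩
  · refine ⟨fun _ _ => 1, measurable_const, fun z => ?_⟩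
    simp [codedBranches]
  classical
  let C (m : ℕ) : Set Z := closure (g '' {v | ∃ n, Encodable.encode (PiNat.res v n) = m})
  refine ⟨fun z m => if z ∈ C m then 0 else 1, ?_, fun z => ?_⟩
  · rw [measurable_pi_iff]
    exact fun m => Measurable.ite isClosed_closure.measurableSet measurable_const measurable_const
  have hC (w : NN) (n : ℕ) :
      C (Encodable.encode (PiNat.res w n)) = closure (g '' PiNat.cylinder w n) := by
    simp only [C, PiNat.cylinder_eq_res]
    congr 2
    ext v
    simp only [mem_ofPred_eq, Encodable.encode_inj]
    constructor
    · rintro ⟨k, hk⟩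
      have hkn := congrArg List.length hk
      rw [PiNat.res_length, PiNat.res_length] at hkn
      exact hkn ▸ hk
    · exact fun h => ⟨n, h⟩
  simp only [codedBranches, mem_ofPred_eq, hC, ite_eq_left_iff, one_ne_zero, imp_false, not_not]
  constructor
  · rintro ⟨w, rfl⟩
    exact ⟨w, fun n => subset_closure ⟨w, PiNat.self_mem_cylinder w n, rfl⟩⟩
  · rintro ⟨w, hw⟩
    refine ⟨w, ?_⟩
    by_contra hne
    obtain ⟨V, ⟨hV, hVc⟩, hVz⟩ := (closed_nhds_basis (g w)).mem_iff.1
      (isOpen_compl_singleton.mem_nhds (show g w ∈ ({z} : Set Z)ᶜ from hne))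
    obtain ⟨U, ⟨x, n, rfl⟩, hwU, hUV⟩ := (PiNat.isTopologicalBasis_cylinders fun _ => ℕ).mem_nhds_iff.1
      (hg.continuousAt.preimage_mem_nhds hV)
    rw [← PiNat.mem_cylinder_iff_eq.1 hwU] at hUV
    exact hVz (closure_minimal (image_subset_iff.2 hUV) hVc (hw n)) rfl

/-- For every analytic `A ⊆ ℕ^ℕ` there is a `Π⁰₂` set `B ⊆ ℕ^ℕ × [ℕ]^ℕ` such that
`s ∈ A` iff the section `B_s` is non-dominating; consequently the collection of
non-dominating `Π⁰₂` subsets of `[ℕ]^ℕ` is `Σ¹₁`-hard in the codes. -/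
theorem nondominating_Pi02_sets_Sigma11_hard :
    (∀ A : Set NN, AnalyticSet A →
      ∃ B : Set (NN × IncSeq), IsPi02 B ∧
        ∀ s : NN, s ∈ A ↔ ¬ Dominating {x : IncSeq | (s, x) ∈ B}) ∧
    (∃ B : Set (NN × IncSeq), IsPi02 B ∧
      Sigma11Hard {s : NN | ¬ Dominating {x : IncSeq | (s, x) ∈ B}}) := by
  refine ⟨fun A hA => ?_, nonDominators codedBranches,
    isPi02_nonDominators isClosed_codedBranches, ?_⟩
  · rw [AnalyticSet] at hA
    rcases hA with rfl | ⟨g, hg, rfl⟩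
    · refine ⟨_, isPi02_nonDominators isClosed_empty, fun s => ?_⟩
      rw [← exists_mem_iff_not_dominating]
      simp
    · refine ⟨_, isPi02_nonDominators
        (isClosed_eq (hg.comp continuous_snd) continuous_fst), fun s => ?_⟩
      rw [← exists_mem_iff_not_dominating]
      rfl
  · simp only [← exists_mem_iff_not_dominating]
    exact sigma11Hard_exists_mem_codedBranches
end

section
/- Let B ⊆ [ℕ]^ℕ be a Borel set and let B' = {x ∈ B : S^j(x) ∈ B for all j ∈ ℕ}. If G_S|_{B'} admits a Borel n-coloring for some finite n, then G_S|_B admits a Borel max{2,n}-coloring. Consequently, if χ_B(G_S|_B) ≥ 3 then χ_B(G_S|_B) = χ_B(G_S|_{B'}). -/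
open MeasureTheory Set

/-- The Borel chromatic number of `G_S|_B`, as an extended natural number
(`⊤` meaning no finite Borel coloring exists). -/
noncomputable def borelChrom (B : Set IncSeq) : ℕ∞ :=
  sInf {k : ℕ∞ | ∃ n : ℕ, k = n ∧ BorelColoringLE B n}

theorem measurable_shift : Measurable shift := by
  have h : Measurable fun x : IncSeq => fun n => x.1 (n + 1) :=
    measurable_pi_lambda _ fun n => (measurable_pi_apply (n + 1)).comp measurable_subtype_coe
  exact h.subtype_mk

/-- The points of `[ℕ]^ℕ` whose whole forward orbit under the shift lies in `B`. -/
abbrev shiftClosure (B : Set IncSeq) : Set IncSeq := {x | ∀ j : ℕ, shift^[j] x ∈ B}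

theorem shiftClosure_subset (B : Set IncSeq) : shiftClosure B ⊆ B := fun _ hx => hx 0

theorem measurableSet_shiftClosure {B : Set IncSeq} (hB : MeasurableSet B) :
    MeasurableSet (shiftClosure B) := by
  have h : shiftClosure B = ⋂ j : ℕ, shift^[j] ⁻¹' B := by ext; simp
  rw [h]
  exact MeasurableSet.iInter fun j => measurable_shift.iterate j hB

theorem shift_mem_shiftClosure_iff {B : Set IncSeq} {x : IncSeq} (hx : x ∈ B) :
    shift x ∈ shiftClosure B ↔ x ∈ shiftClosure B := by
  refine ⟨fun h j => ?_, fun h j => ?_⟩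
  · cases j with
    | zero => exact hx
    | succ j => exact h j
  · exact h (j + 1)

/-- A point of `B` that leaves `B` does so one step later than its shift; hence there is a
Borel function to `ℕ` increasing by one against the shift off `shiftClosure B`. -/
theorem exists_measurable_escapeTime {B : Set IncSeq} (hB : MeasurableSet B) :
    ∃ k : IncSeq → ℕ, Measurable k ∧
      ∀ x ∈ B, x ∉ shiftClosure B → k x = k (shift x) + 1 := by
  classical
  have hex : ∀ x : IncSeq, ∃ j : ℕ, x ∈ shiftClosure B ∨ shift^[j] x ∉ B := by
    intro x
    by_cases hx : x ∈ shiftClosure B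
    · exact ⟨0, Or.inl hx⟩
    · obtain ⟨j, hj⟩ := not_forall.1 hx
      exact ⟨j, Or.inr hj⟩
  refine ⟨fun x => Nat.find (hex x), measurable_find hex fun j =>
    (measurableSet_shiftClosure hB).union (measurable_shift.iterate j hB).compl,
    fun x hxB hx => ?_⟩
  have hSx : shift x ∉ shiftClosure B := (shift_mem_shiftClosure_iff hxB).not.2 hx
  have h0 : ¬ (x ∈ shiftClosure B ∨ shift^[0] x ∉ B) := by
    rintro (h | h)
    exacts [hx h, h hxB]
  show Nat.find (hex x) = Nat.find (hex (shift x)) + 1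
  rw [Nat.find_eq_iff]
  refine ⟨Or.inr ((Nat.find_spec (hex (shift x))).resolve_left hSx), fun m hm => ?_⟩
  cases m with
  | zero => exact h0
  | succ m =>
    rintro (h | h)
    · exact hx h
    · exact Nat.find_min (hex (shift x)) (Nat.lt_of_succ_lt_succ hm) (Or.inr h)

theorem BorelColoringLE.mono_set {A B : Set IncSeq} (hAB : A ⊆ B) {n : ℕ}
    (h : BorelColoringLE B n) : BorelColoringLE A n := by
  obtain ⟨c, hc, hne⟩ := h
  exact ⟨c ∘ Set.inclusion hAB, hc.comp (measurable_inclusion hAB),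
    fun x y hxy => hne (Set.inclusion hAB x) (Set.inclusion hAB y) hxy⟩

/-- To check that a map colors `G_S|_B` properly it suffices to consider edges `{x, S(x)}`. -/
theorem borelColoringLE_of_shift {B : Set IncSeq} {n : ℕ} (c : B → Fin n) (hc : Measurable c)
    (h : ∀ x y : B, x.1 ≠ y.1 → shift x.1 = y.1 → c x ≠ c y) : BorelColoringLE B n := by
  refine ⟨c, hc, ?_⟩
  rintro x y ⟨hne, hxy | hyx⟩
  · exact h x y hne hxy
  · exact (h y x hne.symm hyx).symm

theorem BorelColoringLE.of_shiftClosure {B : Set IncSeq} (hB : MeasurableSet B) {n : ℕ}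
    (h : BorelColoringLE (shiftClosure B) n) : BorelColoringLE B (max 2 n) := by
  classical
  obtain ⟨c, hc, hne⟩ := h
  obtain ⟨k, hk, hkS⟩ := exists_measurable_escapeTime hB
  let parity : ℕ → Fin (max 2 n) := fun m =>
    ⟨m % 2, (Nat.mod_lt m two_pos).trans_le (le_max_left 2 n)⟩
  let s : Set B := Subtype.val ⁻¹' shiftClosure B
  let f : s → Fin (max 2 n) := fun x => Fin.castLE (le_max_right 2 n) (c ⟨x.1.1, x.2⟩)
  let g : (sᶜ : Set B) → Fin (max 2 n) := fun x => parity (k x.1.1)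
  have hf : Measurable f := (measurable_of_finite (Fin.castLE (le_max_right 2 n))).comp
    (hc.comp ((measurable_subtype_coe.comp measurable_subtype_coe).subtype_mk))
  have hg : Measurable g := (measurable_of_countable parity).comp
    (hk.comp (measurable_subtype_coe.comp measurable_subtype_coe))
  have hs : MeasurableSet s := measurable_subtype_coe (measurableSet_shiftClosure hB)
  refine borelColoringLE_of_shift (fun x => if hx : x ∈ s then f ⟨x, hx⟩ else g ⟨x, hx⟩)
    (hf.dite hg hs) fun x y hxy hSx => ?_
  have hiff : y ∈ s ↔ x ∈ s := by
    have := shift_mem_shiftClosure_iff x.2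
    rwa [hSx] at this
  by_cases hx : x ∈ s
  · have hy := hiff.2 hx
    simp only [hx, hy, dite_true]
    exact fun he => hne ⟨x.1, hx⟩ ⟨y.1, hy⟩ ⟨hxy, Or.inl hSx⟩
      (Fin.castLE_injective (le_max_right 2 n) he)
  · have hy := hiff.not.2 hx
    simp only [hx, hy, dite_false]
    intro he
    have hmod : k x.1 % 2 = k y.1 % 2 := congrArg Fin.val he
    have hstep := hkS x.1 x.2 hx
    rw [hSx] at hstep
    omega

/-- Let `B ⊆ [ℕ]^ℕ` be Borel and `B' = {x ∈ B : S^j(x) ∈ B for all j}`.  If `G_S|_{B'}`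
has a Borel `n`-coloring for a finite `n`, then `G_S|_B` has a Borel `max 2 n`-coloring;
consequently if `χ_B(G_S|_B) ≥ 3` then `χ_B(G_S|_B) = χ_B(G_S|_{B'})`. -/
theorem coloring_extends_to_shift_closure (B : Set IncSeq) (hB : MeasurableSet B) :
    (∀ n : ℕ, BorelColoringLE {x : IncSeq | ∀ j : ℕ, shift^[j] x ∈ B} n →
      BorelColoringLE B (max 2 n)) ∧
    (¬ BorelColoringLE B 2 →
      borelChrom B = borelChrom {x : IncSeq | ∀ j : ℕ, shift^[j] x ∈ B}) := by
  refine ⟨fun n h => h.of_shiftClosure hB, fun h2 => le_antisymm ?_ ?_⟩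
  · refine le_sInf ?_
    rintro _ ⟨n, rfl, hn⟩
    have hmax := BorelColoringLE.of_shiftClosure hB hn
    rcases le_total n 2 with hle | hle
    · exact absurd (max_eq_left hle ▸ hmax) h2
    · exact sInf_le ⟨n, rfl, max_eq_right hle ▸ hmax⟩
  · refine sInf_le_sInf ?_
    rintro _ ⟨n, rfl, hn⟩
    exact ⟨n, rfl, hn.mono_set (shiftClosure_subset B)⟩
end
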